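/- arXiv:2212.03941 — 2 statements merged into one kernel-verified Lean document; each statement's English description precedes it below -/
import Mathlib

section
/- Let K be a field with 6 invertible in K and let t : V × V → T be a fully nondegenerate alternating K-tensor whose Pfaffian defines an elliptic curve in P²_K with a K-rational flex point, i.e. the matrix of linear forms B representing t satisfies det(B) = f² for a smooth homogeneous cubic f ∈ K[y₁,y₂,y₃] whose zero locus has a K-rational flex point. Then: (1) |𝒯(t)| = 2 if and only if Cent(t) = {(λ·id_V, λ·id_V, λ·id_T) : λ ∈ K} and Adj(t) is *-isomorphic to X₁(K); (2) |𝒯(t)| > 2 if and only if Cent(t) = {(λ·id_V, λ·id_V, λ·id_T) : λ ∈ K} and Adj(t) is *-isomorphic to S₂(K). -/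
open Matrix

/-- The tensor `(u, v) ↦ (uᵀ B₁ v, …, uᵀ B_d v)` given coefficient matrices. -/
def matTensor {K : Type*} [CommRing K] {ι : Type*} [Fintype ι] {d : ℕ}
    (B : Fin d → Matrix ι ι K) (u v : ι → K) : Fin d → K :=
  fun k => u ⬝ᵥ (B k).mulVec v

/-- The matrix of linear forms `B = B₁y₁ + ⋯ + B_d y_d` over `K[y₁,…,y_d]`. -/
noncomputable def polyMat {K : Type*} [CommRing K] {ι : Type*} {d : ℕ}
    (B : Fin d → Matrix ι ι K) : Matrix ι ι (MvPolynomial (Fin d) K) :=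
  Matrix.of fun i j => ∑ k, MvPolynomial.C (B k i j) * MvPolynomial.X k

/-- A homogeneous cubic `f ∈ K[y₁,y₂,y₃]` is smooth if `f` and its three partial derivatives
have no common nontrivial zero over an algebraic closure of `K`. -/
def SmoothCubic {K : Type*} [Field K] (f : MvPolynomial (Fin 3) K) : Prop :=
  f.IsHomogeneous 3 ∧
    ∀ v : Fin 3 → AlgebraicClosure K, v ≠ 0 →
      ¬ ((MvPolynomial.aeval v) f = 0 ∧ ∀ k, (MvPolynomial.aeval v) (MvPolynomial.pderiv k f) = 0)

/-- The zero locus of `f` has a `K`-rational flex point: a nontrivial `K`-point of `f = 0`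
at which the determinant of the Hessian matrix of `f` also vanishes. -/
noncomputable def HasRationalFlex {K : Type*} [Field K] (f : MvPolynomial (Fin 3) K) : Prop :=
  ∃ v : Fin 3 → K, v ≠ 0 ∧ MvPolynomial.eval v f = 0 ∧
    MvPolynomial.eval v
      (Matrix.det (Matrix.of fun i j => MvPolynomial.pderiv i (MvPolynomial.pderiv j f))) = 0

/-- The centroid in matrix form: triples `(A, C, D)` with `Aᵀ·B_k = B_k·C` and
`Aᵀ·B_k = Σ_l D_{kl}·B_l` for all `k`. -/
def centTriples {K : Type*} [CommRing K] {ι : Type*} [Fintype ι] [DecidableEq ι] {d : ℕ}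
    (B : Fin d → Matrix ι ι K) :
    Set (Matrix ι ι K × Matrix ι ι K × Matrix (Fin d) (Fin d) K) :=
  {c | (∀ k, (c.1)ᵀ * B k = B k * c.2.1) ∧ (∀ k, (c.1)ᵀ * B k = ∑ l, c.2.2 k l • B l)}

/-- The adjoint algebra in matrix form: pairs `(A, C)` with `Aᵀ·B_k = B_k·C`. -/
def adjPair {K : Type*} [CommRing K] {ι : Type*} [Fintype ι] [DecidableEq ι] {d : ℕ}
    (M : Fin d → Matrix ι ι K) : Set (Matrix ι ι K × Matrix ι ι K) :=
  {p | ∀ k, (p.1)ᵀ * M k = M k * p.2}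

/-- `A` is *-isomorphic to `X₁(K) = K ⊕ K` with the swap involution. -/
def StarIsoX1 {K : Type*} [Field K] {ι : Type*} [Fintype ι] [DecidableEq ι]
    (A : Set (Matrix ι ι K × Matrix ι ι K)) : Prop :=
  ∃ e : A ≃ (K × K),
    (∀ x y z : A, z.val = x.val + y.val → e z = e x + e y) ∧
    (∀ (c : K) (x z : A), z.val = c • x.val → e z = c • e x) ∧
    (∀ x y z : A, z.val.1 = x.val.1 * y.val.1 ∧ z.val.2 = y.val.2 * x.val.2 →
      e z = e x * e y) ∧
    (∀ z : A, z.val = 1 → e z = 1) ∧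
    (∀ x z : A, z.val.1 = x.val.2 ∧ z.val.2 = x.val.1 → e z = Prod.swap (e x))

/-- `A` is *-isomorphic to `S₂(K) = Mat₂(K)` with involution `X ↦ J·Xᵀ·J⁻¹`,
`J = [[0,1],[−1,0]]`. -/
def StarIsoS2 {K : Type*} [Field K] {ι : Type*} [Fintype ι] [DecidableEq ι]
    (A : Set (Matrix ι ι K × Matrix ι ι K)) : Prop :=
  ∃ e : A ≃ Matrix (Fin 2) (Fin 2) K,
    (∀ x y z : A, z.val = x.val + y.val → e z = e x + e y) ∧
    (∀ (c : K) (x z : A), z.val = c • x.val → e z = c • e x) ∧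
    (∀ x y z : A, z.val.1 = x.val.1 * y.val.1 ∧ z.val.2 = y.val.2 * x.val.2 →
      e z = e x * e y) ∧
    (∀ z : A, z.val = 1 → e z = 1) ∧
    (∀ x z : A, z.val.1 = x.val.2 ∧ z.val.2 = x.val.1 →
      e z = !![0, 1; -1, 0] * (e x)ᵀ * !![0, -1; 1, 0])

section Smooth

namespace MvPolynomial

theorem IsHomogeneous.aeval_smul {R A σ : Type*} [CommSemiring R] [CommSemiring A] [Algebra R A]
    {f : MvPolynomial σ R} {n : ℕ} (hf : f.IsHomogeneous n) (c : A) (v : σ → A) :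
    MvPolynomial.aeval (c • v) f = c ^ n * MvPolynomial.aeval v f := by
  simp only [aeval_def, eval₂_eq, Finset.mul_sum]
  refine Finset.sum_congr rfl fun d hd => ?_
  have hdeg : ∑ i ∈ d.support, d i = n := by
    have := hf (mem_support_iff.1 hd)
    rwa [show (Finsupp.weight 1 : (σ →₀ ℕ) →+ ℕ) = Finsupp.degree from
      Finsupp.degree_eq_weight_one.symm, Finsupp.degree_apply] at this
  simp only [Pi.smul_apply, smul_eq_mul, mul_pow, Finset.prod_mul_distrib,
    Finset.prod_pow_eq_pow_sum,
    hdeg]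
  ring

/-- The chain rule for a polynomial composed with univariate polynomials. -/
theorem derivative_aeval {R A σ : Type*} [CommSemiring R] [CommSemiring A] [Algebra R A]
    [Fintype σ] (f : MvPolynomial σ R) (p : σ → Polynomial A) :
    Polynomial.derivative (aeval p f) =
      ∑ k, aeval p (pderiv k f) * Polynomial.derivative (p k) := by
  classical
  induction f using MvPolynomial.induction_on with
  | C a =>
    simp [IsScalarTower.algebraMap_apply R A (Polynomial A)]
  | add f g hf hg => simp [hf, hg, add_mul, Finset.sum_add_distrib]
  | mul_X f i hf =>
    simp only [map_mul, aeval_X, Polynomial.derivative_mul, hf, Derivation.leibniz, pderiv_X,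
      smul_eq_mul, map_add, add_mul, Finset.sum_add_distrib, Finset.sum_mul]
    rw [add_comm]
    congr 1
    · rw [Finset.sum_eq_single i]
      · simp
      · intro k _ hk
        simp [hk.symm]
      · simp
    · exact Finset.sum_congr rfl fun k _ => by ring

end MvPolynomial

open MvPolynomial

variable {K : Type*} [Field K]

/-- Evaluation of a polynomial along the line through `v` with direction `u`. -/
theorem eval_aeval_line {L : Type*} [Field L] [Algebra K L] {σ : Type*} (f : MvPolynomial σ K)
    (v u : σ → L) (s : L) :
    (aeval (fun i => Polynomial.C (v i) + Polynomial.C (u i) * Polynomial.X) f).eval s =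
      aeval (v + s • u) f := by
  have : ((Polynomial.aeval s).restrictScalars K).comp
      (aeval (R := K) fun i => Polynomial.C (v i) + Polynomial.C (u i) * Polynomial.X) =
      aeval (v + s • u) := by
    ext i
    simpa using mul_comm (u i) s
  have h := DFunLike.congr_fun this f
  simpa [Polynomial.coe_aeval_eq_eval] using h

/-- A polynomial vanishing along a line has vanishing directional derivative there. -/
theorem sum_pderiv_mul_eq_zero {L : Type*} [Field L] [Infinite L] [Algebra K L] {σ : Type*}
    [Fintype σ] (f : MvPolynomial σ K) (v u : σ → L) (h : ∀ s : L, aeval (v + s • u) f = 0) :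
    ∑ k, u k * aeval v (pderiv k f) = 0 := by
  set p : σ → Polynomial L := fun i => Polynomial.C (v i) + Polynomial.C (u i) * Polynomial.X
  have hp : aeval p f = 0 := Polynomial.funext fun s => by
    rw [eval_aeval_line, h, Polynomial.eval_zero]
  have hd := derivative_aeval f p
  rw [hp] at hd
  have := congrArg (Polynomial.eval 0) hd
  simp only [p, Polynomial.eval_finsetSum, Polynomial.eval_mul, eval_aeval_line] at this
  simpa [mul_comm (u _)] using this.symm

/-- A binary form of degree two over an algebraically closed field, presented as a polynomial
on a plane, has a nontrivial zero. -/
theorem exists_zero_on_plane {L : Type*} [Field L] [IsAlgClosed L] [Algebra K L] {σ : Type*}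
    (g : (σ → L) → L) (hg : ∀ (c : L) v, g (c • v) = c ^ 2 * g v)
    (hpoly : ∀ v u : σ → L, ∃ p : Polynomial L, ∀ s, p.eval s = g (v + s • u))
    (P : Submodule L (σ → L)) (a b : σ → L) (hab : LinearIndependent L ![a, b])
    (ha : a ∈ P) (hb : b ∈ P) : ∃ v ∈ P, v ≠ 0 ∧ g v = 0 := by
  rw [LinearIndependent.pair_iff] at hab
  obtain ⟨p, hp⟩ := hpoly b a
  obtain ⟨q, hq⟩ := hpoly a b
  by_cases hdeg : p.degree = 0
  · obtain ⟨c, rfl⟩ : ∃ c, p = Polynomial.C c := ⟨_, Polynomial.eq_C_of_degree_eq_zero hdeg⟩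
    simp only [Polynomial.eval_C] at hp
    refine ⟨a, ha, ?_, ?_⟩
    · rintro rfl
      simpa using hab 1 0 (by simp)
    · have hroot : (q - Polynomial.C c * Polynomial.X ^ 2) = 0 := by
        refine Polynomial.eq_zero_of_infinite_isRoot _
          ((Set.finite_singleton (0 : L)).infinite_compl.mono fun t ht => ?_)
        have ht : t ≠ 0 := ht
        have : a + t • b = t • (b + t⁻¹ • a) := by
          rw [smul_add, smul_smul, mul_inv_cancel₀ ht, one_smul, add_comm]
        simp only [Set.mem_ofPred_eq, Polynomial.IsRoot, Polynomial.eval_sub, hq, this, hg, ← hp]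
        simpa [sub_eq_zero] using mul_comm (t ^ 2) c
      have := congrArg (Polynomial.eval 0) hroot
      simpa [hq] using this
  · obtain ⟨s, hs⟩ := IsAlgClosed.exists_root p hdeg
    refine ⟨b + s • a, P.add_mem hb (P.smul_mem s ha), fun h0 => ?_, by rw [← hp]; exact hs⟩
    simpa using (hab s 1 (by rw [one_smul, add_comm]; exact h0)).2

/-- A smooth cubic does not vanish on a line. -/
theorem SmoothCubic.exists_aeval_ne_zero {f : MvPolynomial (Fin 3) K} (hf : SmoothCubic f)
    (l : (Fin 3 → AlgebraicClosure K) →ₗ[AlgebraicClosure K] AlgebraicClosure K) :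
    ∃ y, l y = 0 ∧ aeval y f ≠ 0 := by
  by_contra! hvan
  obtain ⟨l', hl', hvan'⟩ : ∃ l' : (Fin 3 → AlgebraicClosure K) →ₗ[AlgebraicClosure K]
      AlgebraicClosure K, l' ≠ 0 ∧ ∀ y, l' y = 0 → aeval y f = 0 := by
    by_cases h0 : l = 0
    · refine ⟨LinearMap.proj 0, fun h => ?_, fun y _ => hvan y (by simp [h0])⟩
      simpa using LinearMap.congr_fun h (Pi.single 0 1)
    · exact ⟨l, h0, hvan⟩
  obtain ⟨w, hw⟩ : ∃ w, l' w = 1 := LinearMap.surjective hl' 1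
  have hrank : Module.finrank (AlgebraicClosure K) (LinearMap.ker l') = 2 := by
    have h1 := l'.finrank_range_add_finrank_ker
    rw [LinearMap.range_eq_top.2 (LinearMap.surjective hl'), finrank_top] at h1
    simp at h1
    omega
  let b := Module.finBasisOfFinrankEq _ _ hrank
  have hb := b.linearIndependent.map' (LinearMap.ker l').subtype (Submodule.ker_subtype _)
  obtain ⟨v, hv, hv0, hgv⟩ := exists_zero_on_plane (K := K)
    (fun v => ∑ k, w k * aeval v (pderiv k f))
    (fun c v => by
      simp only [Finset.mul_sum]
      exact Finset.sum_congr rfl fun k _ => by rw [hf.1.pderiv.aeval_smul]; ring)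
    (fun v u => ⟨∑ k, Polynomial.C (w k) *
      aeval (fun i => Polynomial.C (v i) + Polynomial.C (u i) * Polynomial.X) (pderiv k f),
      fun s => by simp [Polynomial.eval_finsetSum, eval_aeval_line]⟩)
    (LinearMap.ker l') (b 0) (b 1) (by
      rw [LinearIndependent.pair_iff]
      intro s t hst
      have := Fintype.linearIndependent_iff.1 hb ![s, t] (by simpa [Fin.sum_univ_two] using hst)
      exact ⟨this 0, this 1⟩)
    (b 0).2 (b 1).2
  refine hf.2 v hv0 ⟨hvan' v hv, fun k => ?_⟩
  set e : Fin 3 → AlgebraicClosure K := Pi.single k 1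
  have hu := sum_pderiv_mul_eq_zero f v (e - l' e • w) (fun s => hvan' _ (by
    rw [map_add, LinearMap.mem_ker.1 hv, map_smul, map_sub, map_smul, hw]; simp))
  simp only [Pi.sub_apply, sub_mul, Finset.sum_sub_distrib, Pi.smul_apply, smul_eq_mul,
    mul_assoc, ← Finset.mul_sum, hgv, mul_zero, sub_zero] at hu
  simpa [e, Pi.single_apply] using hu

end Smooth
section Pencil

variable {K L V : Type*} [Field K] [Field L] [Algebra K L] [AddCommGroup V] [Module K V]

/-- A `K`-bilinear pairing with values in an extension `L` of `K` is separating if the functionals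
attached to `K`-independent vectors are `L`-independent, i.e. its extension of scalars to `L`
is nondegenerate on the left. -/
def IsSeparating (β : V →ₗ[K] V →ₗ[K] L) : Prop :=
  ∀ (m : ℕ) (w : Fin m → V), LinearIndependent K w →
    ∀ c : Fin m → L, (∀ x, ∑ i, c i * β (w i) x = 0) → c = 0

theorem IsSeparating.finrank_add_le [FiniteDimensional K V] {β : V →ₗ[K] V →ₗ[K] L}
    (hβ : IsSeparating β) (P Q : Submodule K V) (h : ∀ u ∈ P, ∀ v ∈ Q, β u v = 0) :
    Module.finrank K P + Module.finrank K Q ≤ Module.finrank K V := by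
  by_contra! hlt
  obtain ⟨R, hR⟩ := Q.exists_isCompl
  have hQR := Submodule.finrank_add_eq_of_isCompl hR
  let p := Module.finBasis K P
  let r := Module.finBasis K R
  let G : (Fin (Module.finrank K P) → L) →ₗ[L] (Fin (Module.finrank K R) → L) :=
    (Matrix.of fun i j => β (p i) (r j)).vecMulLinear
  have hker : LinearMap.ker G ≠ ⊥ :=
    G.ker_ne_bot_of_finrank_lt (by simp only [Module.finrank_fin_fun]; omega)
  obtain ⟨c, hc, hc0⟩ := Submodule.exists_mem_ne_zero_of_ne_bot hker
  refine hc0 (hβ _ (fun i => (p i : V)) (p.linearIndependent.map' P.subtype P.ker_subtype) c ?_)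
  let φ : V →ₗ[K] L := ∑ i, (LinearMap.mulLeft K (c i)) ∘ₗ β (p i)
  have hφ : ∀ x, φ x = ∑ i, c i * β (p i) x := fun x => by simp [φ]
  have hr : ∀ j, φ (r j) = 0 := fun j => by
    rw [hφ]
    exact congrFun (LinearMap.mem_ker.1 hc) j
  have hR0 : φ ∘ₗ R.subtype = 0 := r.ext fun j => by simpa using hr j
  intro x
  rw [← hφ]
  obtain ⟨q, hq, s, hs, rfl⟩ := Submodule.mem_sup.1 (hR.sup_eq_top ▸ Submodule.mem_top (x := x))
  have h1 : φ s = 0 := LinearMap.congr_fun hR0 ⟨s, hs⟩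
  rw [map_add, h1, hφ, add_zero]
  exact Finset.sum_eq_zero fun i _ => by rw [h _ (p i).2 _ hq, mul_zero]

theorem Submodule.span_range_coe_basis {κ : Type*} (P : Submodule K V)
    (b : Module.Basis κ K P) : Submodule.span K (Set.range fun i => (b i : V)) = P := by
  have h := congrArg (Submodule.map P.subtype) b.span_eq
  rwa [Submodule.map_span, ← Set.range_comp, Submodule.map_subtype_top] at h

/-- A subspace of dimension `d + 1` is spanned by any subspace of dimension `d` it contains and
one further vector. -/
theorem Submodule.exists_eq_sup_span_singleton [FiniteDimensional K V]
    {P Q : Submodule K V} (hPQ : P ≤ Q) (h : Module.finrank K Q = Module.finrank K P + 1) :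
    ∃ a, Q = P ⊔ Submodule.span K {a} := by
  have hlt : P < Q := lt_of_le_of_ne hPQ (by rintro rfl; omega)
  obtain ⟨a, haQ, haP⟩ := SetLike.exists_of_lt hlt
  refine ⟨a, (Submodule.eq_of_le_of_finrank_le
    (sup_le hPQ ((Submodule.span_singleton_le_iff_mem a Q).2 haQ)) ?_).symm⟩
  have : P < P ⊔ Submodule.span K {a} := left_lt_sup.2 (by
    rwa [Submodule.span_singleton_le_iff_mem])
  have := Submodule.finrank_lt_finrank_of_lt this
  omega

/-- An alternating pencil of pairings, generically separating along every line. -/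
structure IsSmoothPencil (τ : (Fin 3 → L) →ₗ[L] V →ₗ[K] V →ₗ[K] L) : Prop where
  finrank_eq : Module.finrank K V = 6
  self_eq_zero : ∀ y u, τ y u u = 0
  exists_isSeparating : ∀ l : (Fin 3 → L) →ₗ[L] L, ∃ y, l y = 0 ∧ IsSeparating (τ y)

namespace IsSmoothPencil

variable {τ : (Fin 3 → L) →ₗ[L] V →ₗ[K] V →ₗ[K] L}

theorem finiteDimensional (hτ : IsSmoothPencil τ) : FiniteDimensional K V :=
  Module.finite_of_finrank_pos (by rw [hτ.finrank_eq]; norm_num)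

theorem swap (hτ : IsSmoothPencil τ) (y : Fin 3 → L) (u v : V) : τ y u v = -τ y v u := by
  have h := hτ.self_eq_zero y (u + v)
  simp only [map_add, LinearMap.add_apply, hτ.self_eq_zero, zero_add, add_zero] at h
  linear_combination h

/-- The linear form `y ↦ τ y u v`. -/
def form (τ : (Fin 3 → L) →ₗ[L] V →ₗ[K] V →ₗ[K] L) (u v : V) : (Fin 3 → L) →ₗ[L] L where
  toFun y := τ y u v
  map_add' := by simp
  map_smul' := by simp

theorem finrank_add_le (hτ : IsSmoothPencil τ) {P Q : Submodule K V}
    (h : ∀ y, ∀ u ∈ P, ∀ v ∈ Q, τ y u v = 0) :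
    Module.finrank K P + Module.finrank K Q ≤ 6 := by
  have := hτ.finiteDimensional
  obtain ⟨y, -, hy⟩ := hτ.exists_isSeparating 0
  exact (hy.finrank_add_le P Q (h y)).trans_eq hτ.finrank_eq

/-- Two orthogonal subspaces cannot have too large dimension, even when orthogonality only holds on
a line. -/
theorem finrank_add_le_of_line (hτ : IsSmoothPencil τ) {P Q : Submodule K V} (a b : V)
    (h : ∀ y, τ y a b = 0 → ∀ u ∈ P, ∀ v ∈ Q, τ y u v = 0) :
    Module.finrank K P + Module.finrank K Q ≤ 6 := by
  have := hτ.finiteDimensional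
  obtain ⟨y, hy0, hy⟩ := hτ.exists_isSeparating (form τ a b)
  exact (hy.finrank_add_le P Q (h y hy0)).trans_eq hτ.finrank_eq

/-- An alternating form vanishing on `P ⊥ (P + ⟨a, b⟩)` and on `(a, b)` vanishes on
`P + ⟨a, b⟩`. -/
theorem eq_zero_on_sup (hτ : IsSmoothPencil τ) {P : Submodule K V} {a b : V} {y : Fin 3 → L}
    (h : ∀ u ∈ P, ∀ v ∈ P ⊔ Submodule.span K {a} ⊔ Submodule.span K {b}, τ y u v = 0)
    (hab : τ y a b = 0) :
    ∀ u ∈ P ⊔ Submodule.span K {a} ⊔ Submodule.span K {b},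
      ∀ v ∈ P ⊔ Submodule.span K {a} ⊔ Submodule.span K {b}, τ y u v = 0 := by
  have key : ∀ u ∈ P ⊔ Submodule.span K {a} ⊔ Submodule.span K {b}, ∃ p ∈ P, ∃ s t : K,
      u = p + s • a + t • b := by
    intro u hu
    obtain ⟨x, hx, z, hz, rfl⟩ := Submodule.mem_sup.1 hu
    obtain ⟨p, hp, w, hw, rfl⟩ := Submodule.mem_sup.1 hx
    obtain ⟨s, rfl⟩ := Submodule.mem_span_singleton.1 hw
    obtain ⟨t, rfl⟩ := Submodule.mem_span_singleton.1 hz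
    exact ⟨p, hp, s, t, rfl⟩
  intro u hu v hv
  obtain ⟨p, hp, s, t, rfl⟩ := key u hu
  obtain ⟨q, hq, s', t', rfl⟩ := key v hv
  have h1 := h p hp _ hv
  have h2 := h q hq (s • a + t • b) (by
    have := Submodule.sub_mem _ hu (Submodule.mem_sup_left (Submodule.mem_sup_left hp))
    rwa [add_assoc, add_sub_cancel_left] at this)
  rw [hτ.swap] at h2
  have hba := hτ.swap y b a
  simp only [map_add, LinearMap.add_apply, map_smul, LinearMap.smul_apply, hτ.self_eq_zero, hab,
    smul_zero, add_zero, neg_eq_zero, neg_zero, smul_add] at h1 h2 hba ⊢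
  rw [hba]
  simp only [smul_zero, add_zero]
  linear_combination h1 + h2

/-- Orthogonal nested subspaces of complementary dimensions are trivial or equal. -/
theorem eq_bot_or_eq_of_le (hτ : IsSmoothPencil τ) {P Q : Submodule K V} (hPQ : P ≤ Q)
    (h : ∀ y, ∀ u ∈ P, ∀ v ∈ Q, τ y u v = 0)
    (hdim : Module.finrank K P + Module.finrank K Q = 6) : P = ⊥ ∨ P = Q := by
  have := hτ.finiteDimensional
  have hle := Submodule.finrank_mono hPQ
  obtain h0 | h1 | h2 | h3 : Module.finrank K P = 0 ∨ Module.finrank K P = 1 ∨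
      Module.finrank K P = 2 ∨ Module.finrank K P = 3 := by omega
  · exact Or.inl (Submodule.finrank_eq_zero.1 h0)
  · exfalso
    obtain ⟨a, ha⟩ := Submodule.exists_eq_sup_span_singleton (bot_le (a := P))
      (by rw [finrank_bot, h1])
    obtain ⟨b, hb⟩ := Submodule.exists_eq_sup_span_singleton (le_top (a := Q))
      (by rw [finrank_top, hτ.finrank_eq]; omega)
    have := hτ.finrank_add_le_of_line (P := P) (Q := ⊤) a b (by
      intro y hy u hu v hv
      rw [hb] at hv
      rw [ha, bot_sup_eq] at hu
      obtain ⟨s, rfl⟩ := Submodule.mem_span_singleton.1 hu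
      obtain ⟨q, hq, z, hz, rfl⟩ := Submodule.mem_sup.1 hv
      obtain ⟨t, rfl⟩ := Submodule.mem_span_singleton.1 hz
      have := h y a (by rw [ha]; exact Submodule.mem_sup_right (Submodule.mem_span_singleton_self a))
        q hq
      simp [hy, this])
    rw [finrank_top, hτ.finrank_eq] at this
    omega
  · exfalso
    obtain ⟨R, hPR, hRQ, hR⟩ : ∃ R, P ≤ R ∧ R ≤ Q ∧ Module.finrank K R = 3 := by
      obtain ⟨a, haQ, haP⟩ := SetLike.exists_of_lt (lt_of_le_of_ne hPQ (by rintro rfl; omega))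
      refine ⟨P ⊔ Submodule.span K {a}, le_sup_left,
        sup_le hPQ ((Submodule.span_singleton_le_iff_mem a Q).2 haQ), le_antisymm ?_ ?_⟩
      · have := Submodule.finrank_add_le_finrank_add_finrank P (Submodule.span K {a})
        have := finrank_span_le_card (R := K) ({a} : Set V)
        simp at this
        omega
      · have := Submodule.finrank_lt_finrank_of_lt
          (left_lt_sup.2 (by rwa [Submodule.span_singleton_le_iff_mem]) :
            P < P ⊔ Submodule.span K {a})
        omega
    obtain ⟨a, rfl⟩ := Submodule.exists_eq_sup_span_singleton hPR (by omega)
    obtain ⟨b, rfl⟩ := Submodule.exists_eq_sup_span_singleton hRQ (by omega)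
    have := hτ.finrank_add_le_of_line a b fun y hy => hτ.eq_zero_on_sup (h y) hy
    omega
  · exact Or.inr (Submodule.eq_of_le_of_finrank_le hPQ (by omega))

/-- Three functionals forming a skew-symmetric `3 × 3` block are never independent. -/
theorem false_of_skew_triple (hτ : IsSmoothPencil τ) (h2 : (2 : L) ≠ 0) {Q : Submodule K V}
    (w v : Fin 3 → V)
    (hw : LinearIndependent K w) (hv : Q ⊔ Submodule.span K (Set.range v) = ⊤)
    (hwQ : ∀ y i, ∀ q ∈ Q, τ y (w i) q = 0)
    (hskew : ∀ y i j, τ y (w i) (v j) = -τ y (w j) (v i)) : False := by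
  obtain ⟨y, -, hy⟩ := hτ.exists_isSeparating 0
  let G : Matrix (Fin 3) (Fin 3) L := Matrix.of fun i j => τ y (w i) (v j)
  have hG : Gᵀ = -G := by ext i j; exact hskew y j i
  have hdet : G.det = 0 := by
    have h := congrArg Matrix.det hG
    rw [det_transpose, det_neg, Fintype.card_fin] at h
    have : 2 * G.det = 0 := by linear_combination h
    exact (mul_eq_zero.1 this).resolve_left h2
  obtain ⟨c, hc0, hc⟩ := exists_vecMul_eq_zero_iff.2 hdet
  refine hc0 (hy 3 w hw c ?_)
  let φ : V →ₗ[K] L := ∑ i, (LinearMap.mulLeft K (c i)) ∘ₗ τ y (w i)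
  have hφ : ∀ x, φ x = ∑ i, c i * τ y (w i) x := fun x => by simp [φ]
  have : (⊤ : Submodule K V) ≤ LinearMap.ker φ := by
    rw [← hv, sup_le_iff, Submodule.span_le]
    refine ⟨fun q hq => ?_, ?_⟩
    · rw [LinearMap.mem_ker, hφ]
      exact Finset.sum_eq_zero fun i _ => by rw [hwQ y i q hq, mul_zero]
    · rintro _ ⟨j, rfl⟩
      rw [SetLike.mem_coe, LinearMap.mem_ker, hφ]
      exact congrFun hc j
  exact fun x => (hφ x).symm.trans (this Submodule.mem_top)

/-- There is no nontrivial orthogonal direct sum decomposition. -/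
theorem eq_bot_of_isCompl (hτ : IsSmoothPencil τ) (h2 : (2 : L) ≠ 0) {P Q : Submodule K V}
    (hPQ : IsCompl P Q) (h : ∀ y, ∀ u ∈ P, ∀ v ∈ Q, τ y u v = 0)
    (hle : Module.finrank K P ≤ Module.finrank K Q) : P = ⊥ := by
  have := hτ.finiteDimensional
  have hdim := Submodule.finrank_add_eq_of_isCompl hPQ
  rw [hτ.finrank_eq] at hdim
  have hlt : ∀ a b : V, (∀ y, τ y a b = 0 → ∀ u ∈ P, ∀ v ∈ P, τ y u v = 0) →
      Module.finrank K P = 0 := by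
    intro a b hab
    have := hτ.finrank_add_le_of_line (P := P) (Q := ⊤) a b (by
      intro y hy u hu v hv
      rw [← hPQ.sup_eq_top] at hv
      obtain ⟨p, hp, q, hq, rfl⟩ := Submodule.mem_sup.1 hv
      rw [map_add, hab y hy u hu p hp, h y u hu q hq, add_zero])
    rw [finrank_top, hτ.finrank_eq] at this
    omega
  obtain h0 | h1 | h2' | h3 : Module.finrank K P = 0 ∨ Module.finrank K P = 1 ∨
      Module.finrank K P = 2 ∨ Module.finrank K P = 3 := by omega
  · exact Submodule.finrank_eq_zero.1 h0
  · exfalso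
    obtain ⟨a, rfl⟩ := Submodule.exists_eq_sup_span_singleton (bot_le (a := P))
      (by rw [finrank_bot, h1])
    have := hlt a 0 (by
      intro y _ u hu v hv
      rw [bot_sup_eq] at hu hv
      obtain ⟨s, rfl⟩ := Submodule.mem_span_singleton.1 hu
      obtain ⟨t, rfl⟩ := Submodule.mem_span_singleton.1 hv
      simp [hτ.self_eq_zero])
    omega
  · exfalso
    obtain ⟨a, ha, ha0⟩ := Submodule.exists_mem_ne_zero_of_ne_bot
      (p := P) (by rintro rfl; simp at h2')
    obtain ⟨b, rfl⟩ := Submodule.exists_eq_sup_span_singleton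
      (P := ⊥ ⊔ Submodule.span K {a}) (Q := P)
      (by rw [bot_sup_eq]; exact (Submodule.span_singleton_le_iff_mem a P).2 ha)
      (by rw [bot_sup_eq, finrank_span_singleton ha0, h2'])
    have := hlt a b fun y hy => hτ.eq_zero_on_sup (by simp) hy
    omega
  · exfalso
    let b := (Module.finBasisOfFinrankEq K P h3)
    refine hτ.false_of_skew_triple h2 (Q := Q) (fun i => (b i : V)) (fun i => (b i : V))
      (b.linearIndependent.map' P.subtype P.ker_subtype) ?_ (fun y i q hq => h y _ (b i).2 q hq)
      (fun y i j => hτ.swap y _ _)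
    rw [P.span_range_coe_basis b, sup_comm, hPQ.sup_eq_top]

/-- Nonzero orthogonal subspaces of complementary dimensions coincide. -/
theorem eq_of_orthogonal (hτ : IsSmoothPencil τ) (h2 : (2 : L) ≠ 0) {P Q : Submodule K V}
    (h : ∀ y, ∀ u ∈ P, ∀ v ∈ Q, τ y u v = 0)
    (hdim : Module.finrank K P + Module.finrank K Q = 6) (hP : P ≠ ⊥) (hQ : Q ≠ ⊥) : P = Q := by
  have := hτ.finiteDimensional
  have hsum := Submodule.finrank_sup_add_finrank_inf_eq P Q
  have hRS : ∀ y, ∀ u ∈ P ⊓ Q, ∀ v ∈ P ⊔ Q, τ y u v = 0 := by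
    intro y u hu v hv
    obtain ⟨p, hp, q, hq, rfl⟩ := Submodule.mem_sup.1 hv
    rw [map_add, h y u hu.1 q hq, hτ.swap, h y p hp u hu.2, neg_zero, add_zero]
  rcases hτ.eq_bot_or_eq_of_le (inf_le_left.trans le_sup_left) hRS (by omega) with h0 | h1
  · exfalso
    have hc : IsCompl P Q := by
      refine ⟨disjoint_iff.2 h0, codisjoint_iff.2 (Submodule.eq_top_of_finrank_eq ?_)⟩
      rw [h0, finrank_bot] at hsum
      rw [hτ.finrank_eq]
      omega
    rcases le_total (Module.finrank K P) (Module.finrank K Q) with hle | hle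
    · exact hP (hτ.eq_bot_of_isCompl h2 hc h hle)
    · exact hQ (hτ.eq_bot_of_isCompl h2 hc.symm
        (fun y u hu v hv => by rw [hτ.swap, h y v hv u hu, neg_zero]) hle)
  · exact inf_eq_sup.1 h1

/-- A self-adjoint operator with nonzero kernel vanishes. -/
theorem eq_zero_of_selfAdjoint (hτ : IsSmoothPencil τ) (h2 : (2 : L) ≠ 0) (N : V →ₗ[K] V)
    (hN : ∀ y u v, τ y (N u) v = τ y u (N v)) (hker : LinearMap.ker N ≠ ⊥) : N = 0 := by
  have := hτ.finiteDimensional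
  by_contra hN0
  have hrn := N.finrank_range_add_finrank_ker
  rw [hτ.finrank_eq] at hrn
  have heq : LinearMap.ker N = LinearMap.range N := by
    refine hτ.eq_of_orthogonal h2 ?_ (by omega) hker (by rwa [Ne, LinearMap.range_eq_bot])
    rintro y u hu _ ⟨v, rfl⟩
    rw [← hN, LinearMap.mem_ker.1 hu, map_zero, LinearMap.zero_apply]
  obtain ⟨R, hR⟩ := (LinearMap.ker N).exists_isCompl
  have hR3 : Module.finrank K R = 3 := by
    have := Submodule.finrank_add_eq_of_isCompl hR
    rw [hτ.finrank_eq] at this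
    rw [heq] at this hrn
    omega
  let b := Module.finBasisOfFinrankEq K R hR3
  have hb : LinearIndependent K fun i => (b i : V) :=
    b.linearIndependent.map' R.subtype R.ker_subtype
  have hspan : Submodule.span K (Set.range fun i => (b i : V)) = R :=
    R.span_range_coe_basis b
  refine hτ.false_of_skew_triple h2 (Q := LinearMap.ker N) (fun i => N (b i)) (fun i => (b i : V))
    (hb.map (f := N) (by rw [hspan]; exact hR.disjoint.symm)) (by rw [hspan, hR.sup_eq_top]) ?_ ?_
  · intro y i q hq
    rw [hN, LinearMap.mem_ker.1 hq, map_zero]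
  · intro y i j
    rw [hN, hτ.swap]

end IsSmoothPencil
end Pencil
section Bridge

variable {K : Type*} [Field K] {ι : Type*} [Fintype ι]

theorem matTensor_mulVec_left (B : Fin 3 → Matrix ι ι K) (A : Matrix ι ι K) (u v : ι → K) :
    matTensor B (A *ᵥ u) v = fun k => u ⬝ᵥ (Aᵀ * B k) *ᵥ v := by
  ext k
  rw [matTensor, dotProduct_mulVec, vecMul_mulVec, dotProduct_mulVec]

theorem matTensor_self_eq_zero (h2 : (2 : K) ≠ 0) {B : Fin 3 → Matrix ι ι K}
    (hskew : ∀ k, (B k)ᵀ = -(B k)) (u : ι → K) : matTensor B u u = 0 := by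
  ext k
  have h : u ⬝ᵥ (B k) *ᵥ u = -(u ⬝ᵥ (B k) *ᵥ u) := by
    conv_lhs => rw [dotProduct_mulVec, ← mulVec_transpose, hskew, neg_mulVec, neg_dotProduct,
      dotProduct_comm]
  have : 2 * (u ⬝ᵥ (B k) *ᵥ u) = 0 := by linear_combination h
  exact (mul_eq_zero.1 this).resolve_left h2

variable [DecidableEq ι]

/-- The pencil of pairings `(y, u, v) ↦ ∑ₖ yₖ uᵀ Bₖ v`, with parameters in an extension of `K`. -/
noncomputable def pencilPairing (L : Type*) [Field L] [Algebra K L] (B : Fin 3 → Matrix ι ι K) :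
    (Fin 3 → L) →ₗ[L] (ι → K) →ₗ[K] (ι → K) →ₗ[K] L where
  toFun y := ∑ k, y k • (Matrix.toLinearMap₂' K (B k)).compr₂ (Algebra.linearMap K L)
  map_add' y z := by simp [add_smul, Finset.sum_add_distrib]
  map_smul' c y := by simp [mul_smul, Finset.smul_sum]

theorem pencilPairing_apply {L : Type*} [Field L] [Algebra K L] (B : Fin 3 → Matrix ι ι K)
    (y : Fin 3 → L) (u v : ι → K) :
    pencilPairing L B y u v = ∑ k, y k * algebraMap K L (matTensor B u v k) := by
  simp [pencilPairing, matTensor, Matrix.toLinearMap₂'_apply']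

theorem mem_adjPair_iff {B : Fin 3 → Matrix ι ι K} {p : Matrix ι ι K × Matrix ι ι K} :
    p ∈ adjPair B ↔ ∀ u v, matTensor B (p.1 *ᵥ u) v = matTensor B u (p.2 *ᵥ v) := by
  simp only [matTensor_mulVec_left, adjPair, Set.mem_ofPred_eq]
  constructor
  · intro h u v
    ext k
    rw [h k, matTensor, mulVec_mulVec]
  · intro h k
    ext i j
    have := congrFun (h (Pi.single i 1) (Pi.single j 1)) k
    simp only [matTensor, mulVec_single_one, single_one_dotProduct] at this
    exact this

theorem isSeparating_pencilPairing {L : Type*} [Field L] [Algebra K L]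
    (B : Fin 3 → Matrix ι ι K) (y : Fin 3 → L)
    (hy : (∑ k, y k • (B k).map (algebraMap K L)).det ≠ 0) :
    IsSeparating (pencilPairing L B y) := by
  intro m w hw c hc
  let W : ι → L := ∑ i, c i • fun j => algebraMap K L (w i j)
  have hW : W = 0 := by
    refine Matrix.eq_zero_of_vecMul_eq_zero hy ?_
    refine funext fun j => Eq.trans ?_ (hc (Pi.single j 1))
    simp only [pencilPairing_apply, W, matTensor, mulVec_single_one, Finset.sum_apply,
      Pi.smul_apply, smul_eq_mul, Finset.mul_sum, Finset.sum_mul, vecMul, dotProduct, map_sum,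
      map_mul, Matrix.sum_apply, Matrix.smul_apply, Matrix.map_apply, col_apply]
    refine Finset.sum_comm.trans (Eq.trans ?_ Finset.sum_comm)
    refine Finset.sum_congr rfl fun k _ => Finset.sum_comm.trans ?_
    refine Finset.sum_congr rfl fun i _ => Finset.sum_congr rfl fun x _ => ?_
    ring
  obtain ⟨g, hg⟩ := (Fintype.linearCombination K w).exists_leftInverse_of_injective
    (LinearMap.ker_eq_bot.2 (linearIndependent_iff_injective_fintypeLinearCombination.1 hw))
  ext i
  have h1 : ∀ i', g (w i') = Pi.single i' 1 := fun i' => by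
    have := LinearMap.congr_fun hg (Pi.single i' 1)
    simpa [Fintype.linearCombination_apply_single] using this
  have h2 : ∑ j, algebraMap K L (LinearMap.toMatrix' g i j) * W j = c i := by
    have h3 : ∀ i', ∑ j, algebraMap K L (LinearMap.toMatrix' g i j) * algebraMap K L (w i' j) =
        if i = i' then 1 else 0 := fun i' => by
      have := congrFun (LinearMap.toMatrix'_mulVec g (w i')) i
      rw [h1] at this
      simp only [mulVec, dotProduct] at this
      simp only [← map_mul, ← map_sum, this, Pi.single_apply]
      split_ifs <;> simp
    simp only [W, Finset.sum_apply, Pi.smul_apply, smul_eq_mul, Finset.mul_sum]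
    rw [Finset.sum_comm]
    simp only [mul_left_comm _ (c _), ← Finset.mul_sum, h3]
    simp
  rw [← h2, hW]
  simp

theorem isSmoothPencil_pencilPairing {L : Type*} [Field L] [Algebra K L] (h2 : (2 : K) ≠ 0)
    {B : Fin 3 → Matrix ι ι K} (hskew : ∀ k, (B k)ᵀ = -(B k)) (hcard : Fintype.card ι = 6)
    (h : ∀ l : (Fin 3 → L) →ₗ[L] L, ∃ y, l y = 0 ∧
      (∑ k, y k • (B k).map (algebraMap K L)).det ≠ 0) :
    IsSmoothPencil (pencilPairing L B) where
  finrank_eq := by simpa using hcard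
  self_eq_zero y u := by
    rw [pencilPairing_apply, matTensor_self_eq_zero h2 hskew]
    simp
  exists_isSeparating l :=
    let ⟨y, hy, hy'⟩ := h l
    ⟨y, hy, isSeparating_pencilPairing B y hy'⟩

theorem det_pencil_eq {L : Type*} [Field L] [Algebra K L] {B : Fin 3 → Matrix ι ι K}
    (y : Fin 3 → L) :
    (∑ k, y k • (B k).map (algebraMap K L)).det = MvPolynomial.aeval y (polyMat B).det := by
  rw [AlgHom.map_det]
  congr 1
  ext i j
  simp [polyMat, Matrix.sum_apply, mul_comm]

/-- The size of the matrix of linear forms is determined by the degree of its determinant. -/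
theorem card_eq_six {L : Type*} [Field L] [Infinite L] [Algebra K L]
    {B : Fin 3 → Matrix ι ι K} {f : MvPolynomial (Fin 3) K} (hf : f.IsHomogeneous 3)
    (hdet : (polyMat B).det = f ^ 2) {y : Fin 3 → L} (hy : MvPolynomial.aeval y f ≠ 0) :
    Fintype.card ι = 6 := by
  have h : (Polynomial.X ^ Fintype.card ι : Polynomial L) = Polynomial.X ^ 6 := by
    refine Polynomial.funext fun c => ?_
    have h1 := det_pencil_eq (B := B) (c • y)
    have h2 := det_pencil_eq (B := B) y
    simp only [Pi.smul_apply, smul_assoc, ← Finset.smul_sum, det_smul, hdet, map_pow] at h1 h2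
    rw [h2, hf.aeval_smul] at h1
    simp only [Polynomial.eval_pow, Polynomial.eval_X]
    refine mul_right_cancel₀ (pow_ne_zero 2 hy) ?_
    linear_combination h1
  simpa using congrArg Polynomial.natDegree h

end Bridge

section Adjoint

variable {K L : Type*} [Field K] [Field L] [Algebra K L] {ι : Type*} [Fintype ι]
  {B : Fin 3 → Matrix ι ι K}

theorem eq_of_forall_mul_eq (hnd : ∀ u, (∀ w, matTensor B u w = 0) → u = 0)
    (hskew : ∀ k, (B k)ᵀ = -(B k)) {C C' : Matrix ι ι K} (h : ∀ k, B k * C = B k * C') :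
    C = C' := by
  refine mulVec_injective (funext fun v => sub_eq_zero.1 (hnd _ fun w => ?_))
  ext k
  have hv : B k *ᵥ (C *ᵥ v - C' *ᵥ v) = 0 := by
    rw [mulVec_sub, mulVec_mulVec, mulVec_mulVec, h k, sub_self]
  rw [matTensor, dotProduct_mulVec, ← mulVec_transpose, hskew, neg_mulVec, hv]
  simp

variable [DecidableEq ι]

theorem add_mem_adjPair {p q : Matrix ι ι K × Matrix ι ι K} (hp : p ∈ adjPair B)
    (hq : q ∈ adjPair B) : p + q ∈ adjPair B := fun k => by
  rw [Prod.fst_add, Prod.snd_add, transpose_add, add_mul, mul_add, hp k, hq k]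

theorem smul_mem_adjPair (c : K) {p : Matrix ι ι K × Matrix ι ι K} (hp : p ∈ adjPair B) :
    c • p ∈ adjPair B := fun k => by
  rw [Prod.smul_fst, Prod.smul_snd, transpose_smul, Matrix.smul_mul, Matrix.mul_smul, hp k]

theorem one_mem_adjPair : (1, 1) ∈ adjPair B := fun k => by simp

theorem mul_mem_adjPair {A C A' C' : Matrix ι ι K} (h : (A, C) ∈ adjPair B)
    (h' : (A', C') ∈ adjPair B) : (A * A', C' * C) ∈ adjPair B := fun k => by
  have h1 : Aᵀ * B k = B k * C := h k
  have h2 : A'ᵀ * B k = B k * C' := h' k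
  change (A * A')ᵀ * B k = B k * (C' * C)
  rw [transpose_mul, Matrix.mul_assoc, h1, ← Matrix.mul_assoc, h2, Matrix.mul_assoc]

theorem swap_mem_adjPair (hskew : ∀ k, (B k)ᵀ = -(B k)) {A C : Matrix ι ι K}
    (h : (A, C) ∈ adjPair B) : (C, A) ∈ adjPair B := fun k => by
  have h1 : Aᵀ * B k = B k * C := h k
  have h2 := congrArg Matrix.transpose h1
  simp only [transpose_mul, transpose_transpose, hskew, Matrix.neg_mul, Matrix.mul_neg,
    neg_inj] at h2
  exact h2.symm

theorem adjPair_snd_unique (hnd : ∀ u, (∀ w, matTensor B u w = 0) → u = 0)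
    (hskew : ∀ k, (B k)ᵀ = -(B k)) {A C C' : Matrix ι ι K} (h : (A, C) ∈ adjPair B)
    (h' : (A, C') ∈ adjPair B) : C = C' :=
  eq_of_forall_mul_eq hnd hskew fun k => (h k).symm.trans (h' k)

theorem pencilPairing_eq_zero {u v : ι → K} (h : matTensor B u v = 0) (y : Fin 3 → L) :
    pencilPairing L B y u v = 0 := by
  simp [pencilPairing_apply, h]

theorem pencilPairing_adj {A C : Matrix ι ι K} (h : (A, C) ∈ adjPair B) (y : Fin 3 → L)
    (u v : ι → K) :
    pencilPairing L B y (A *ᵥ u) v = pencilPairing L B y u (C *ᵥ v) := by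
  rw [pencilPairing_apply, pencilPairing_apply, mem_adjPair_iff.1 h]

/-- The totally isotropic subspaces of half the dimension. -/
def lagrangians (B : Fin 3 → Matrix ι ι K) : Set (Submodule K (ι → K)) :=
  {U | (∀ u ∈ U, ∀ w ∈ U, matTensor B u w = 0) ∧
    2 * Module.finrank K U = Module.finrank K (ι → K)}

/-- Distinct half-dimensional totally isotropic subspaces are complementary. -/
theorem isCompl_of_mem_lagrangians (hτ : IsSmoothPencil (pencilPairing L B))
    {U W : Submodule K (ι → K)} (hU : U ∈ lagrangians B) (hW : W ∈ lagrangians B) (hUW : U ≠ W) :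
    IsCompl U W := by
  have hU3 := hU.2
  have hW3 := hW.2
  rw [hτ.finrank_eq] at hU3 hW3
  have hsum := Submodule.finrank_sup_add_finrank_inf_eq U W
  have horth : ∀ y, ∀ u ∈ U ⊓ W, ∀ v ∈ U ⊔ W, pencilPairing L B y u v = 0 := by
    intro y u hu v hv
    obtain ⟨p, hp, q, hq, rfl⟩ := Submodule.mem_sup.1 hv
    rw [map_add, pencilPairing_eq_zero (hU.1 u hu.1 p hp),
      pencilPairing_eq_zero (hW.1 u hu.2 q hq), add_zero]
  rcases hτ.eq_bot_or_eq_of_le (inf_le_left.trans le_sup_left) horth (by omega) with h | h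
  · refine ⟨disjoint_iff.2 h, codisjoint_iff.2 (Submodule.eq_top_of_finrank_eq ?_)⟩
    rw [h, finrank_bot] at hsum
    rw [hτ.finrank_eq]
    omega
  · exact absurd (inf_eq_sup.1 h) hUW

/-- The projection attached to two complementary totally isotropic subspaces. -/
theorem exists_idempotent_of_isCompl {U W : Submodule K (ι → K)}
    (hU : ∀ u ∈ U, ∀ w ∈ U, matTensor B u w = 0) (hW : ∀ u ∈ W, ∀ w ∈ W, matTensor B u w = 0)
    (hUW : IsCompl U W) :
    ∃ p : Matrix ι ι K, p * p = p ∧ (p, 1 - p) ∈ adjPair B ∧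
      LinearMap.range p.mulVecLin = U ∧ LinearMap.range (1 - p).mulVecLin = W := by
  let π := U.projection W hUW
  have hp : ∀ v, LinearMap.toMatrix' π *ᵥ v = π v := LinearMap.toMatrix'_mulVec π
  have hq : ∀ v, (1 - LinearMap.toMatrix' π) *ᵥ v = W.projection U hUW.symm v := fun v => by
    rw [sub_mulVec, one_mulVec, hp, Submodule.projection_eq_self_sub_projection hUW]
  refine ⟨LinearMap.toMatrix' π, ?_, ?_, ?_, ?_⟩
  · rw [← LinearMap.toMatrix'_mul]
    exact congrArg _ (Submodule.isIdempotentElem_projection hUW)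
  · rw [mem_adjPair_iff]
    intro u v
    simp only [hp, hq]
    have hadd : ∀ x, π x + W.projection U hUW.symm x = x := fun x => by
      rw [← hq, sub_mulVec, one_mulVec, hp, add_sub_cancel]
    conv_lhs => rw [← hadd v]
    conv_rhs => rw [← hadd u]
    have h1 := hU _ (Submodule.projection_apply_mem hUW u) _ (Submodule.projection_apply_mem hUW v)
    have h2 := hW _ (Submodule.projection_apply_mem hUW.symm u) _
      (Submodule.projection_apply_mem hUW.symm v)
    ext k
    have h1 := congrFun h1 k
    have h2 := congrFun h2 k
    simp only [matTensor, mulVec_add, dotProduct_add, add_dotProduct, Pi.zero_apply] at h1 h2 ⊢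
    rw [h2, h1]
    ring
  · rw [← Submodule.range_projection hUW]
    congr 1
    exact LinearMap.ext hp
  · rw [← Submodule.range_projection hUW.symm]
    congr 1
    exact LinearMap.ext hq

/-- The image of an idempotent `p` of the adjoint algebra with `p* = 1 - p` is a
half-dimensional totally isotropic subspace. -/
theorem range_mem_lagrangians (hτ : IsSmoothPencil (pencilPairing L B)) {p : Matrix ι ι K}
    (hp : p * p = p) (hadj : (p, 1 - p) ∈ adjPair B) (hswap : (1 - p, p) ∈ adjPair B) :
    LinearMap.range p.mulVecLin ∈ lagrangians B := by
  have key : ∀ q : Matrix ι ι K, q * q = q → (q, 1 - q) ∈ adjPair B →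
      ∀ u ∈ LinearMap.range q.mulVecLin, ∀ v ∈ LinearMap.range q.mulVecLin,
        matTensor B u v = 0 := by
    rintro q hq hqadj _ ⟨u, rfl⟩ _ ⟨v, rfl⟩
    have := mem_adjPair_iff.1 hqadj u (q *ᵥ v)
    simp only [mulVec_mulVec, sub_mul, one_mul, hq, sub_self, zero_mulVec] at this
    rw [mulVecLin_apply, mulVecLin_apply, this]
    ext k
    simp [matTensor]
  have hq : (1 - p) * (1 - p) = 1 - p := by
    rw [sub_mul, one_mul, mul_sub, mul_one, hp, sub_self, sub_zero]
  have hp3 := hτ.finrank_add_le fun y u hu v hv =>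
    pencilPairing_eq_zero (key p hp hadj u hu v hv) y
  have hq3 := hτ.finrank_add_le fun y u hu v hv =>
    pencilPairing_eq_zero (key (1 - p) hq (by
      rw [sub_sub_cancel]; exact hswap) u hu v hv) y
  have hle : LinearMap.ker p.mulVecLin ≤ LinearMap.range (1 - p).mulVecLin := fun v hv =>
    ⟨v, by rw [mulVecLin_apply, sub_mulVec, one_mulVec]; simpa using hv⟩
  have := Submodule.finrank_mono hle
  have hrn := p.mulVecLin.finrank_range_add_finrank_ker
  refine ⟨key p hp hadj, ?_⟩
  rw [hτ.finrank_eq] at hrn ⊢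
  omega

end Adjoint

section Classification

variable {K : Type*} [Field K] {ι : Type*} [Fintype ι] [DecidableEq ι] {B : Fin 3 → Matrix ι ι K}

theorem isSmoothPencil_of_smoothCubic {L : Type*} [Field L] [Algebra K L]
    [Algebra L (AlgebraicClosure K)] [IsScalarTower K L (AlgebraicClosure K)] (h2 : (2 : L) ≠ 0)
    (hskew : ∀ k, (B k)ᵀ = -(B k)) {f : MvPolynomial (Fin 3) K} (hf : SmoothCubic f)
    (hdet : (polyMat B).det = f ^ 2) :
    IsSmoothPencil
      (pencilPairing (AlgebraicClosure K) fun k => (B k).map (algebraMap K L)) := by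
  refine isSmoothPencil_pencilPairing h2 (fun k => ?_) ?_ fun l => ?_
  · ext i j
    have := congrFun (congrFun (hskew k) i) j
    rw [transpose_apply] at this
    simp [this]
  · obtain ⟨y, -, hy⟩ := hf.exists_aeval_ne_zero 0
    exact card_eq_six hf.1 hdet hy
  · obtain ⟨y, hy0, hy⟩ := hf.exists_aeval_ne_zero l
    refine ⟨y, hy0, ?_⟩
    have h : ∀ k, ((B k).map (algebraMap K L)).map (algebraMap L (AlgebraicClosure K)) =
        (B k).map (algebraMap K (AlgebraicClosure K)) := fun k => by
      ext i j
      simp [← IsScalarTower.algebraMap_apply]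
    simp only [h, det_pencil_eq, hdet, map_pow]
    exact pow_ne_zero 2 hy

/-- Self-adjoint elements of the adjoint algebra are scalar. -/
theorem exists_eq_smul_one {L : Type*} [Field L] [IsAlgClosed L] [Algebra K L] (h2 : (2 : L) ≠ 0)
    (hτ : IsSmoothPencil (pencilPairing L fun k => (B k).map (algebraMap K L)))
    {A : Matrix ι ι K} (hA : (A, A) ∈ adjPair B) : ∃ c : K, A = c • 1 := by
  have hcard := hτ.finrank_eq
  rw [Module.finrank_fintype_fun_eq_card] at hcard
  have : Nonempty ι := Fintype.card_pos_iff.1 (by omega)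
  let A' := A.map (algebraMap K L)
  have hA' : (A', A') ∈ adjPair fun k => (B k).map (algebraMap K L) := fun k => by
    have h : Aᵀ * B k = B k * A := hA k
    change A'ᵀ * (B k).map _ = (B k).map _ * A'
    rw [← transpose_map, ← Matrix.map_mul, ← Matrix.map_mul, h]
  obtain ⟨μ, hμ⟩ := Module.End.exists_eigenvalue (Matrix.toLin' A')
  have hN := hτ.eq_zero_of_selfAdjoint h2 (Matrix.toLin' A' - μ • 1)
    (fun y u v => by
      have := pencilPairing_adj hA' y u v
      simp only [LinearMap.sub_apply, LinearMap.smul_apply, Module.End.one_apply, map_sub,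
        map_smul, Matrix.toLin'_apply, this])
    (by rwa [← Module.End.eigenspace_def])
  have hA1 : A' = μ • 1 := by
    have := congrArg LinearMap.toMatrix' (sub_eq_zero.1 hN)
    rwa [LinearMap.toMatrix'_toLin', map_smul, LinearMap.toMatrix'_one] at this
  obtain ⟨i₀⟩ := this
  have hμA : algebraMap K L (A i₀ i₀) = μ := by
    have := congrFun (congrFun hA1 i₀) i₀
    simpa [A'] using this
  refine ⟨A i₀ i₀, Matrix.ext fun i j => (algebraMap K L).injective ?_⟩
  have := congrFun (congrFun hA1 i) j
  rw [← hμA] at this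
  simpa [A', one_apply, apply_ite] using this

/-- If the self-adjoint elements are scalar, so is the centroid. -/
theorem centTriples_eq (hnd : ∀ u, (∀ w, matTensor B u w = 0) → u = 0)
    (hskew : ∀ k, (B k)ᵀ = -(B k))
    (hfull : Submodule.span K {w : Fin 3 → K | ∃ u v, matTensor B u v = w} = ⊤)
    (hS : ∀ A, (A, A) ∈ adjPair B → ∃ c : K, A = c • 1) :
    centTriples B = {c | ∃ lam : K, c = (lam • 1, lam • 1, lam • 1)} := by
  ext ⟨A, C, D⟩
  constructor
  · rintro ⟨h1, h2⟩
    dsimp only at h1 h2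
    have h3 : ∀ k, Aᵀ * B k = B k * A := fun k => by
      have := congrArg Matrix.transpose (h2 k)
      simp only [transpose_mul, transpose_transpose, hskew, transpose_sum, transpose_smul,
        smul_neg, Finset.sum_neg_distrib, Matrix.neg_mul, neg_inj] at this
      rw [h2, this]
    obtain rfl : A = C := eq_of_forall_mul_eq hnd hskew fun k => (h3 k).symm.trans (h1 k)
    obtain ⟨c, rfl⟩ := hS A h1
    refine ⟨c, Prod.ext rfl (Prod.ext rfl (Matrix.ext fun k l => ?_))⟩
    let φ : (Fin 3 → K) →ₗ[K] K := Fintype.linearCombination K (D k) - c • LinearMap.proj k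
    have hφ : φ = 0 := by
      refine LinearMap.ext_on hfull ?_
      rintro _ ⟨u, v, rfl⟩
      have := congrArg (fun M => u ⬝ᵥ M *ᵥ v) (h2 k)
      simp only [transpose_smul, transpose_one, Matrix.smul_mul, one_mul, smul_mulVec,
        sum_mulVec, dotProduct_smul, dotProduct_sum] at this
      simp only [smul_eq_mul] at this
      simp [φ, Fintype.linearCombination_apply, matTensor, this, mul_comm]
    have := LinearMap.congr_fun hφ (Pi.single l 1)
    simp only [φ, LinearMap.sub_apply, LinearMap.smul_apply, LinearMap.proj_apply,
      Fintype.linearCombination_apply_single, LinearMap.zero_apply, one_smul] at this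
    refine (sub_eq_zero.1 this).trans ?_
    simp [one_apply, Pi.single_apply]
  · rintro ⟨c, h⟩
    obtain ⟨rfl, h⟩ := Prod.ext_iff.1 h
    obtain ⟨rfl, rfl⟩ := Prod.ext_iff.1 h
    refine ⟨fun k => by simp, fun k => ?_⟩
    simp [one_apply]

/-- A parametrization of the adjoint algebra by its first components is an equivalence. -/
theorem exists_equiv_adjPair (hnd : ∀ u, (∀ w, matTensor B u w = 0) → u = 0)
    (hskew : ∀ k, (B k)ᵀ = -(B k)) {R : Type*} (G : R → Matrix ι ι K × Matrix ι ι K)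
    (hmem : ∀ X, G X ∈ adjPair B) (hinj : Function.Injective fun X => (G X).1)
    (hsurj : ∀ A C, (A, C) ∈ adjPair B → ∃ X, (G X).1 = A) :
    ∃ e : adjPair B ≃ R, ∀ x, G (e x) = x.val := by
  let g : R → adjPair B := fun X => ⟨G X, hmem X⟩
  have hg : Function.Bijective g := by
    refine ⟨fun X Y hXY => hinj (congrArg (fun z => z.val.1) hXY), ?_⟩
    rintro ⟨⟨A, C⟩, hA⟩
    obtain ⟨X, rfl⟩ := hsurj A C hA
    exact ⟨X, Subtype.ext (Prod.ext rfl (adjPair_snd_unique hnd hskew (hmem X) hA))⟩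
  exact ⟨(Equiv.ofBijective g hg).symm, fun x =>
    congrArg Subtype.val ((Equiv.ofBijective g hg).apply_symm_apply x)⟩

theorem Matrix.mul_transpose_mul_fin_two (X : Matrix (Fin 2) (Fin 2) K) :
    !![0, 1; -1, 0] * Xᵀ * !![0, -1; 1, 0] = !![X 1 1, -X 0 1; -X 1 0, X 0 0] := by
  ext i j
  fin_cases i <;> fin_cases j <;> simp [vecMul, dotProduct, Matrix.mul_apply]

/-- A decomposition of the identity into nonzero idempotents of the adjoint algebra exchanged by
the involution. -/
structure IsPolarization (B : Fin 3 → Matrix ι ι K) (p q : Matrix ι ι K) : Prop where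
  add_eq_one : p + q = 1
  mul_self : p * p = p
  mem : (p, q) ∈ adjPair B
  mem_swap : (q, p) ∈ adjPair B
  ne_zero_left : p ≠ 0
  ne_zero_right : q ≠ 0

namespace IsPolarization

variable {p q : Matrix ι ι K}

theorem right_eq (h : IsPolarization B p q) : q = 1 - p := eq_sub_of_add_eq' h.add_eq_one

theorem mul_self_right (h : IsPolarization B p q) : q * q = q := by
  rw [h.right_eq, sub_mul, one_mul, mul_sub, mul_one, h.mul_self, sub_self, sub_zero]

theorem mul_eq_zero (h : IsPolarization B p q) : p * q = 0 := by
  rw [h.right_eq, mul_sub, mul_one, h.mul_self, sub_self]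

theorem mul_eq_zero' (h : IsPolarization B p q) : q * p = 0 := by
  rw [h.right_eq, sub_mul, one_mul, h.mul_self, sub_self]

theorem symm (h : IsPolarization B p q) : IsPolarization B q p :=
  ⟨by rw [add_comm, h.add_eq_one], h.mul_self_right, h.mem_swap, h.mem, h.ne_zero_right,
    h.ne_zero_left⟩

theorem eq_sum_corners (h : IsPolarization B p q) (A : Matrix ι ι K) :
    A = p * A * p + p * A * q + (q * A * p + q * A * q) := by
  rw [← mul_add, ← mul_add, h.add_eq_one, mul_one, mul_one, ← add_mul, h.add_eq_one, one_mul]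

/-- The diagonal corners of the adjoint algebra are scalar. -/
theorem exists_corner_eq (h : IsPolarization B p q)
    (hS : ∀ A, (A, A) ∈ adjPair B → ∃ c : K, A = c • 1) {A C : Matrix ι ι K}
    (hA : (A, C) ∈ adjPair B) (hC : (C, A) ∈ adjPair B) :
    ∃ c : K, p * A * p = c • p ∧ q * C * q = c • q := by
  have h1 := mul_mem_adjPair (mul_mem_adjPair h.mem hA) h.mem
  have h2 := mul_mem_adjPair (mul_mem_adjPair h.mem_swap hC) h.mem_swap
  rw [← mul_assoc] at h1 h2
  have h3 := add_mem_adjPair h1 h2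
  rw [Prod.mk_add_mk, add_comm (q * C * q)] at h3
  obtain ⟨c, hc⟩ := hS _ h3
  refine ⟨c, ?_, ?_⟩
  · have := congrArg (p * ·) hc
    simpa [mul_add, ← mul_assoc, h.mul_self, h.mul_eq_zero] using this
  · have := congrArg (q * ·) hc
    simpa [mul_add, ← mul_assoc, h.mul_self_right, h.mul_eq_zero'] using this

/-- Off-diagonal corners of the adjoint algebra are skew. -/
theorem corner_mem (h : IsPolarization B p q)
    (hS : ∀ A, (A, A) ∈ adjPair B → ∃ c : K, A = c • 1) {A C : Matrix ι ι K}
    (hA : (A, C) ∈ adjPair B) (hC : (C, A) ∈ adjPair B) :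
    (p * A * q, -(p * A * q)) ∈ adjPair B := by
  have h1 := mul_mem_adjPair (mul_mem_adjPair h.mem hA) h.mem_swap
  have h2 := mul_mem_adjPair (mul_mem_adjPair h.mem hC) h.mem_swap
  rw [← mul_assoc] at h1 h2
  have h3 := add_mem_adjPair h1 h2
  rw [Prod.mk_add_mk, add_comm (p * C * q)] at h3
  obtain ⟨c, hc⟩ := hS _ h3
  have h4 := congrArg (· * p) hc
  simp only [add_mul, mul_assoc, h.mul_eq_zero', mul_zero, add_zero, Matrix.smul_mul,
    one_mul] at h4
  have hc0 : c = 0 := (smul_eq_zero.1 h4.symm).resolve_right h.ne_zero_left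
  rw [hc0, zero_smul] at hc
  rwa [← eq_neg_of_add_eq_zero_right hc]

theorem starIsoX1 (h : IsPolarization B p q)
    (hnd : ∀ u, (∀ w, matTensor B u w = 0) → u = 0) (hskew : ∀ k, (B k)ᵀ = -(B k))
    (hS : ∀ A, (A, A) ∈ adjPair B → ∃ c : K, A = c • 1)
    (hcorner : ∀ A C, (A, C) ∈ adjPair B → p * A * q = 0 ∧ q * A * p = 0) :
    StarIsoX1 (adjPair B) := by
  obtain ⟨G, hG⟩ : ∃ G : K × K → Matrix ι ι K × Matrix ι ι K,
      ∀ x, G x = x.1 • (p, q) + x.2 • (q, p) := ⟨_, fun _ => rfl⟩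
  have hG1 : ∀ x, (G x).1 = x.1 • p + x.2 • q := fun x => by rw [hG]; rfl
  have hG2 : ∀ x, (G x).2 = x.1 • q + x.2 • p := fun x => by rw [hG]; rfl
  have hinj : Function.Injective fun X => (G X).1 := by
    intro x y hxy
    have h1 := congrArg (p * ·) hxy
    have h2 := congrArg (q * ·) hxy
    simp only [hG1, mul_add, Matrix.mul_smul, h.mul_self, h.mul_eq_zero, h.mul_eq_zero',
      h.mul_self_right, smul_zero, add_zero, zero_add] at h1 h2
    exact Prod.ext (smul_left_injective K h.ne_zero_left h1)
      (smul_left_injective K h.ne_zero_right h2)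
  obtain ⟨e, he⟩ := exists_equiv_adjPair hnd hskew G
    (fun x => hG x ▸ add_mem_adjPair (smul_mem_adjPair x.1 h.mem) (smul_mem_adjPair x.2 h.mem_swap))
    hinj fun A C hA => by
      have hC := swap_mem_adjPair hskew hA
      obtain ⟨a, ha, -⟩ := h.exists_corner_eq hS hA hC
      obtain ⟨b, -, hb⟩ := h.exists_corner_eq hS hC hA
      refine ⟨(a, b), ?_⟩
      rw [h.eq_sum_corners A, ha, hb, (hcorner A C hA).1, (hcorner A C hA).2, add_zero, zero_add,
        hG1]
  refine ⟨e, fun x y z hz => hinj ?_, fun c x z hz => hinj ?_, fun x y z hz => hinj ?_,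
    fun z hz => hinj ?_, fun x z hz => hinj ?_⟩ <;> dsimp only
  · rw [he, hz, ← he x, ← he y]
    simp only [hG1, Prod.fst_add, Prod.snd_add]
    module
  · rw [he, hz, ← he x]
    simp only [hG1, Prod.smul_fst, Prod.smul_snd, smul_eq_mul]
    module
  · rw [he, hz.1, ← he x, ← he y]
    simp only [hG1, Prod.fst_mul, Prod.snd_mul, mul_add, add_mul, Matrix.mul_smul, Matrix.smul_mul,
      h.mul_self, h.mul_eq_zero, h.mul_eq_zero', h.mul_self_right]
    module
  · rw [he, hz]
    simp [hG1, h.add_eq_one]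
  · rw [he, hz.1, ← he x]
    simp only [hG1, hG2, Prod.fst_swap, Prod.snd_swap]
    module

/-- A nonzero skew off-diagonal element is invertible between the two corners. -/
theorem exists_inverse_corner {L : Type*} [Field L] [Algebra K L]
    (hτ : IsSmoothPencil (pencilPairing L B)) (h : IsPolarization B p q) {N : Matrix ι ι K}
    (hN : (N, -N) ∈ adjPair B) (hpN : p * N = N) (hNp : N * p = 0) (hN0 : N ≠ 0) :
    ∃ N', N * N' = p ∧ N' * N = q ∧ (N', -N') ∈ adjPair B ∧ q * N' = N' ∧ N' * p = N' := by
  have hNN : N * N = 0 := by rw [← hpN, ← mul_assoc, mul_assoc p, hNp, mul_zero, zero_mul]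
  have hNq : N * q = N := by rw [h.right_eq, mul_sub, mul_one, hNp, sub_zero]
  have hrange : LinearMap.range N.mulVecLin = LinearMap.ker N.mulVecLin := by
    have hrn := N.mulVecLin.finrank_range_add_finrank_ker
    rw [hτ.finrank_eq] at hrn
    refine (hτ.eq_bot_or_eq_of_le ?_ ?_ hrn).resolve_left ?_
    · rintro _ ⟨v, rfl⟩
      simp [hNN]
    · rintro y _ ⟨u, rfl⟩ v hv
      rw [mulVecLin_apply, pencilPairing_adj hN, neg_mulVec,
        show N *ᵥ v = 0 from hv, neg_zero, map_zero]
    · rw [LinearMap.range_eq_bot]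
      exact fun h0 => hN0 (Matrix.ext_of_mulVec_single fun i => by
        rw [zero_mulVec]
        exact LinearMap.congr_fun h0 (Pi.single i 1))
  have hker : ∀ X : Matrix ι ι K, N * X = 0 → ∃ Y, X = N * Y := by
    intro X hX
    have : ∀ j, ∃ v, N *ᵥ v = X.col j := fun j => by
      have : X.col j ∈ LinearMap.ker N.mulVecLin := by
        rw [LinearMap.mem_ker, mulVecLin_apply, ← mulVec_single_one, mulVec_mulVec, hX, zero_mulVec]
      rwa [← hrange] at this
    choose v hv using this
    refine ⟨(Matrix.of v)ᵀ, Matrix.ext fun i j => ?_⟩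
    exact (congrFun (hv j) i).symm
  obtain ⟨N₀, hN₀⟩ := hker p hNp
  have h1 : N * (q * N₀ * p) = p := by
    rw [← mul_assoc, ← mul_assoc, hNq, ← hN₀, h.mul_self]
  have h2 : q * (q * N₀ * p) = q * N₀ * p := by
    rw [← mul_assoc, ← mul_assoc, h.mul_self_right]
  have h3 : q * N₀ * p * p = q * N₀ * p := by rw [mul_assoc, h.mul_self]
  generalize q * N₀ * p = N' at h1 h2 h3
  refine ⟨N', h1, ?_, ?_, h2, h3⟩
  · obtain ⟨Y, hY⟩ := hker (N' * N - q) (by rw [mul_sub, ← mul_assoc, h1, hpN, hNq, sub_self])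
    have : p * (N' * N - q) = N' * N - q := by rw [hY, ← mul_assoc, hpN]
    rw [mul_sub, ← h2, ← mul_assoc, ← mul_assoc, h.mul_eq_zero, zero_mul, zero_mul, sub_zero,
      h2] at this
    exact sub_eq_zero.1 this.symm
  · intro k
    have e1 : Nᵀ * B k = B k * -N := hN k
    have e2 : pᵀ * B k = B k * q := h.mem k
    have e3 : qᵀ * B k = B k * p := h.mem_swap k
    have e4 : N'ᵀ * (B k * p) = -(B k * N') := by
      rw [← h1, ← mul_assoc (B k), ← neg_neg (B k * N), ← Matrix.mul_neg, ← e1, Matrix.neg_mul,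
        Matrix.mul_neg, ← mul_assoc, ← mul_assoc, ← transpose_mul, h1, e2, mul_assoc, h2]
    change N'ᵀ * B k = B k * -N'
    rw [← h2, transpose_mul, mul_assoc, e3, h2, ← h3, transpose_mul, mul_assoc, e4, h3,
      Matrix.mul_neg, ← mul_assoc, e2, mul_assoc, h2, Matrix.mul_neg]

theorem starIsoS2 {L : Type*} [Field L] [Algebra K L]
    (hτ : IsSmoothPencil (pencilPairing L B)) (h : IsPolarization B p q)
    (hnd : ∀ u, (∀ w, matTensor B u w = 0) → u = 0) (hskew : ∀ k, (B k)ᵀ = -(B k))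
    (hS : ∀ A, (A, A) ∈ adjPair B → ∃ c : K, A = c • 1)
    {A C : Matrix ι ι K} (hA : (A, C) ∈ adjPair B) (hne : p * A * q ≠ 0) :
    StarIsoS2 (adjPair B) := by
  obtain ⟨N, hN, hpN, hNp, hN0⟩ : ∃ N, (N, -N) ∈ adjPair B ∧ p * N = N ∧ N * p = 0 ∧ N ≠ 0 :=
    ⟨p * A * q, h.corner_mem hS hA (swap_mem_adjPair hskew hA),
      by rw [← mul_assoc, ← mul_assoc, h.mul_self], by rw [mul_assoc, h.mul_eq_zero', mul_zero],
      hne⟩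
  obtain ⟨N', hNN', hN'N, hN', hqN', hN'p⟩ := h.exists_inverse_corner hτ hN hpN hNp hN0
  have hNq : N * q = N := by rw [h.right_eq, mul_sub, mul_one, hNp, sub_zero]
  have hqN : q * N = 0 := by rw [h.right_eq, sub_mul, one_mul, hpN, sub_self]
  have hpN' : p * N' = 0 := by rw [← hqN', ← mul_assoc, h.mul_eq_zero, zero_mul]
  have hN'q : N' * q = 0 := by rw [← hN'p, mul_assoc, h.mul_eq_zero, mul_zero]
  have hNN : N * N = 0 := by rw [← hpN, ← mul_assoc, mul_assoc p, hNp, mul_zero, zero_mul]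
  have hN'N' : N' * N' = 0 := by
    rw [← hqN', ← mul_assoc, mul_assoc q, hN'q, mul_zero, zero_mul]
  obtain ⟨G, hG⟩ : ∃ G : Matrix (Fin 2) (Fin 2) K → Matrix ι ι K × Matrix ι ι K, ∀ X,
      G X = X 0 0 • (p, q) + X 0 1 • (N, -N) + (X 1 0 • (N', -N') + X 1 1 • (q, p)) :=
    ⟨_, fun _ => rfl⟩
  have hG1 : ∀ X, (G X).1 = X 0 0 • p + X 0 1 • N + (X 1 0 • N' + X 1 1 • q) :=
    fun X => by rw [hG]; rfl
  have hG2 : ∀ X, (G X).2 = X 0 0 • q + X 0 1 • -N + (X 1 0 • -N' + X 1 1 • p) :=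
    fun X => by rw [hG]; rfl
  have hinj : Function.Injective fun X => (G X).1 := by
    intro X Y hXY
    have h00 := congrArg (fun Z => p * Z * p) hXY
    have h01 := congrArg (fun Z => p * Z * N') hXY
    have h10 := congrArg (fun Z => N * Z * p) hXY
    have h11 := congrArg (fun Z => N * Z * N') hXY
    simp only [hG1, mul_add, add_mul, Matrix.mul_smul, Matrix.smul_mul, h.mul_self, h.mul_eq_zero,
      hpN, hNp, hNN', hNq, hpN', hNN, smul_zero, add_zero, zero_add] at h00 h01 h10 h11
    have hp := smul_left_injective K h.ne_zero_left
    ext i j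
    fin_cases i <;> fin_cases j
    exacts [hp h00, hp h01, hp h10, hp h11]
  obtain ⟨e, he⟩ := exists_equiv_adjPair hnd hskew G
    (fun X => hG X ▸ add_mem_adjPair (add_mem_adjPair (smul_mem_adjPair (X 0 0) h.mem)
      (smul_mem_adjPair (X 0 1) hN)) (add_mem_adjPair (smul_mem_adjPair (X 1 0) hN')
      (smul_mem_adjPair (X 1 1) h.mem_swap)))
    hinj fun A C hA => by
      have hC := swap_mem_adjPair hskew hA
      have hAN := mul_mem_adjPair hA hN
      have hAN' := mul_mem_adjPair hA hN'
      obtain ⟨a, ha, -⟩ := h.exists_corner_eq hS hA hC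
      obtain ⟨b, -, hb⟩ := h.exists_corner_eq hS hC hA
      obtain ⟨c, hc, -⟩ := h.exists_corner_eq hS hAN' (swap_mem_adjPair hskew hAN')
      obtain ⟨d, -, hd⟩ := h.exists_corner_eq hS (swap_mem_adjPair hskew hAN) hAN
      have hc' : p * A * q = c • N := by
        rw [← hpN, ← Matrix.smul_mul, ← hc, ← hN'N]
        simp only [mul_assoc, hpN]
      have hd' : q * A * p = d • N' := by
        rw [← hqN', ← Matrix.smul_mul, ← hd, ← hNN']
        simp only [mul_assoc, hqN']
      refine ⟨!![a, c; d, b], ?_⟩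
      rw [h.eq_sum_corners A, ha, hb, hc', hd']
      simp [hG1]
  refine ⟨e, fun x y z hz => hinj ?_, fun c x z hz => hinj ?_, fun x y z hz => hinj ?_,
    fun z hz => hinj ?_, fun x z hz => hinj ?_⟩ <;> dsimp only
  · rw [he, hz, ← he x, ← he y]
    simp only [hG1, Prod.fst_add, Matrix.add_apply]
    module
  · rw [he, hz, ← he x]
    simp only [hG1, Prod.smul_fst, Matrix.smul_apply, smul_eq_mul]
    module
  · rw [he, hz.1, ← he x, ← he y]
    simp only [hG1, mul_add, add_mul, Matrix.mul_smul, Matrix.smul_mul, h.mul_self, h.mul_eq_zero,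
      h.mul_eq_zero', h.mul_self_right, hpN, hNp, hNN', hN'N, hNq, hqN, hpN', hN'p, hqN', hN'q,
      hNN, hN'N', Matrix.mul_apply, Fin.sum_univ_two]
    module
  · rw [he, hz]
    simp [hG1, h.add_eq_one]
  · rw [he, hz.1, ← he x, mul_transpose_mul_fin_two]
    simp only [hG1, hG2, of_apply, cons_val]
    module

end IsPolarization

theorem starIsoX1_or_starIsoS2 {L : Type*} [Field L] [Algebra K L]
    (hτ : IsSmoothPencil (pencilPairing L B))
    (hnd : ∀ u, (∀ w, matTensor B u w = 0) → u = 0) (hskew : ∀ k, (B k)ᵀ = -(B k))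
    (hS : ∀ A, (A, A) ∈ adjPair B → ∃ c : K, A = c • 1) {U W : Submodule K (ι → K)}
    (hU : U ∈ lagrangians B) (hW : W ∈ lagrangians B) (hUW : U ≠ W) :
    StarIsoX1 (adjPair B) ∨ StarIsoS2 (adjPair B) := by
  obtain ⟨p, hp, hmem, hpU, hpW⟩ :=
    exists_idempotent_of_isCompl hU.1 hW.1 (isCompl_of_mem_lagrangians hτ hU hW hUW)
  have hne : ∀ (q : Matrix ι ι K) (Q : Submodule K (ι → K)), Q ∈ lagrangians B →
      LinearMap.range q.mulVecLin = Q → q ≠ 0 := by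
    rintro q Q hQ rfl rfl
    have := hQ.2
    rw [hτ.finrank_eq, mulVecLin_zero, LinearMap.range_zero, finrank_bot] at this
    omega
  have h : IsPolarization B p (1 - p) :=
    ⟨add_sub_cancel _ _, hp, hmem, swap_mem_adjPair hskew hmem, hne _ U hU hpU, hne _ W hW hpW⟩
  by_cases hcorner : ∀ A C, (A, C) ∈ adjPair B → p * A * (1 - p) = 0 ∧ (1 - p) * A * p = 0
  · exact Or.inl (h.starIsoX1 hnd hskew hS hcorner)
  · push Not at hcorner
    obtain ⟨A, C, hA, hAC⟩ := hcorner
    by_cases h0 : p * A * (1 - p) = 0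
    · exact Or.inr (h.symm.starIsoS2 hτ hnd hskew hS hA (hAC h0))
    · exact Or.inr (h.starIsoS2 hτ hnd hskew hS hA h0)

/-- A ring isomorphism from the adjoint algebra to `R` intertwining the involution with `σ`. -/
structure IsStarIso {R : Type*} [Ring R] (e : adjPair B ≃ R) (σ : R → R) : Prop where
  map_add : ∀ x y z : adjPair B, z.val = x.val + y.val → e z = e x + e y
  map_mul : ∀ x y z : adjPair B, z.val.1 = x.val.1 * y.val.1 ∧ z.val.2 = y.val.2 * x.val.2 →
    e z = e x * e y
  map_one : ∀ z : adjPair B, z.val = 1 → e z = 1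
  map_star : ∀ x z : adjPair B, z.val.1 = x.val.2 ∧ z.val.2 = x.val.1 → e z = σ (e x)

namespace IsStarIso

variable {R : Type*} [Ring R] {e : adjPair B ≃ R} {σ : R → R}

/-- The subspace attached to an element of `R`. -/
noncomputable def subspace (e : adjPair B ≃ R) (X : R) : Submodule K (ι → K) :=
  LinearMap.range (e.symm X).val.1.mulVecLin

theorem symm_mul (he : IsStarIso e σ) (X Y : R) :
    (e.symm (X * Y)).val.1 = (e.symm X).val.1 * (e.symm Y).val.1 := by
  let z : adjPair B := ⟨_, mul_mem_adjPair (e.symm X).2 (e.symm Y).2⟩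
  have : e z = X * Y := by simpa using he.map_mul _ _ z ⟨rfl, rfl⟩
  rw [← this, e.symm_apply_apply]

theorem symm_snd (he : IsStarIso e σ) (hskew : ∀ k, (B k)ᵀ = -(B k)) {X : R}
    (hX : σ X = 1 - X) : (e.symm X).val.2 = 1 - (e.symm X).val.1 := by
  let z : adjPair B := ⟨_, swap_mem_adjPair hskew (e.symm X).2⟩
  let w : adjPair B := ⟨_, add_mem_adjPair (e.symm X).2 z.2⟩
  have hz : e z = 1 - X := by rw [he.map_star (e.symm X) z ⟨rfl, rfl⟩, e.apply_symm_apply, hX]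
  have hw : e w = 1 := by
    rw [he.map_add _ z w rfl, hz, e.apply_symm_apply, add_sub_cancel]
  have := e.injective (hw.trans (he.map_one ⟨(1, 1), one_mem_adjPair⟩ rfl).symm)
  exact eq_sub_of_add_eq' (congrArg (fun x => x.val.1) this)

theorem subspace_mem_lagrangians {L : Type*} [Field L] [Algebra K L]
    (hτ : IsSmoothPencil (pencilPairing L B)) (hskew : ∀ k, (B k)ᵀ = -(B k))
    (he : IsStarIso e σ) {X : R} (hX : X * X = X) (hσ : σ X = 1 - X) :
    subspace e X ∈ lagrangians B := by
  have h : ((e.symm X).val.1, 1 - (e.symm X).val.1) ∈ adjPair B := by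
    rw [← he.symm_snd hskew hσ]
    exact (e.symm X).2
  exact range_mem_lagrangians hτ (by rw [← he.symm_mul, hX]) h (swap_mem_adjPair hskew h)

theorem mul_eq_of_subspace_eq (hnd : ∀ u, (∀ w, matTensor B u w = 0) → u = 0)
    (hskew : ∀ k, (B k)ᵀ = -(B k)) (he : IsStarIso e σ) {X Y : R} (hX : X * X = X)
    (h : subspace e X = subspace e Y) : X * Y = Y := by
  have h1 : (e.symm (X * Y)).val.1 = (e.symm Y).val.1 := by
    rw [he.symm_mul]
    refine mulVec_injective (funext fun v => ?_)
    obtain ⟨w, hw⟩ : (e.symm Y).val.1 *ᵥ v ∈ subspace e X := h ▸ ⟨v, rfl⟩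
    rw [← mulVec_mulVec, ← hw, mulVecLin_apply, mulVec_mulVec, ← he.symm_mul, hX]
  refine e.symm.injective (Subtype.ext (Prod.ext h1 ?_))
  have h2 := (e.symm (X * Y)).2
  refine adjPair_snd_unique (A := (e.symm Y).val.1) hnd hskew ?_ (e.symm Y).2
  rw [← h1]
  exact h2

theorem exists_subspace_eq {L : Type*} [Field L] [Algebra K L]
    (hτ : IsSmoothPencil (pencilPairing L B)) (hskew : ∀ k, (B k)ᵀ = -(B k))
    (he : IsStarIso e σ) {U W : Submodule K (ι → K)} (hU : U ∈ lagrangians B)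
    (hW : W ∈ lagrangians B) (hUW : U ≠ W) :
    ∃ X, X * X = X ∧ X + σ X = 1 ∧ U = subspace e X := by
  obtain ⟨p, hp, hmem, rfl, -⟩ :=
    exists_idempotent_of_isCompl hU.1 hW.1 (isCompl_of_mem_lagrangians hτ hU hW hUW)
  let x : adjPair B := ⟨(p, 1 - p), hmem⟩
  let y : adjPair B := ⟨(1 - p, p), swap_mem_adjPair hskew hmem⟩
  refine ⟨e x, ?_, ?_, ?_⟩
  · refine (he.map_mul x x x ⟨hp.symm, ?_⟩).symm
    change 1 - p = (1 - p) * (1 - p)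
    rw [sub_mul, one_mul, mul_sub, mul_one, hp, sub_self, sub_zero]
  · rw [← he.map_star x y ⟨rfl, rfl⟩, ← he.map_one ⟨(1, 1), one_mem_adjPair⟩ rfl]
    exact (he.map_add x y _ (Prod.ext (add_sub_cancel p 1).symm (sub_add_cancel 1 p).symm)).symm
  · rw [subspace, e.symm_apply_apply]

end IsStarIso

theorem lagrangians_eq_pair_of_starIsoX1 {L : Type*} [Field L] [Algebra K L]
    (hτ : IsSmoothPencil (pencilPairing L B))
    (hnd : ∀ u, (∀ w, matTensor B u w = 0) → u = 0) (hskew : ∀ k, (B k)ᵀ = -(B k))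
    (h : StarIsoX1 (adjPair B)) : ∃ U W, U ≠ W ∧ lagrangians B = {U, W} := by
  obtain ⟨e, h1, -, h3, h4, h5⟩ := h
  have he : IsStarIso e Prod.swap := ⟨h1, h3, h4, h5⟩
  have hU : IsStarIso.subspace e (1, 0) ∈ lagrangians B :=
    he.subspace_mem_lagrangians hτ hskew (by simp) (by ext <;> simp)
  have hW : IsStarIso.subspace e (0, 1) ∈ lagrangians B :=
    he.subspace_mem_lagrangians hτ hskew (by simp) (by ext <;> simp)
  have hUW : IsStarIso.subspace e (1, 0) ≠ IsStarIso.subspace e (0, 1) := fun heq => by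
    simpa using he.mul_eq_of_subspace_eq hnd hskew (by simp) heq
  refine ⟨_, _, hUW, Set.Subset.antisymm (fun Q hQ => ?_) ?_⟩
  · by_cases hQU : Q = IsStarIso.subspace e (1, 0)
    · exact Or.inl hQU
    obtain ⟨⟨a, b⟩, hX, hσ, rfl⟩ := he.exists_subspace_eq hτ hskew hQ hU hQU
    have ha : a * a = a := congrArg Prod.fst hX
    have hab : a + b = 1 := congrArg Prod.fst hσ
    rcases IsIdempotentElem.iff_eq_zero_or_one.1 ha with rfl | rfl
    · rw [zero_add] at hab
      exact Or.inr (by rw [hab]; rfl)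
    · exact absurd (by rw [add_eq_left.1 hab]) hQU
  · rintro _ (rfl | rfl)
    exacts [hU, hW]

theorem exists_three_lagrangians_of_starIsoS2 {L : Type*} [Field L] [Algebra K L]
    (hτ : IsSmoothPencil (pencilPairing L B))
    (hnd : ∀ u, (∀ w, matTensor B u w = 0) → u = 0) (hskew : ∀ k, (B k)ᵀ = -(B k))
    (h : StarIsoS2 (adjPair B)) :
    ∃ U W X, U ∈ lagrangians B ∧ W ∈ lagrangians B ∧ X ∈ lagrangians B ∧
      U ≠ W ∧ U ≠ X ∧ W ≠ X := by
  obtain ⟨e, h1, -, h3, h4, h5⟩ := h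
  have he : IsStarIso e fun X => !![0, 1; -1, 0] * Xᵀ * !![0, -1; 1, 0] := ⟨h1, h3, h4, h5⟩
  have hmem : ∀ X : Matrix (Fin 2) (Fin 2) K, X * X = X →
      !![X 1 1, -X 0 1; -X 1 0, X 0 0] = 1 - X → IsStarIso.subspace e X ∈ lagrangians B :=
    fun X hX hσ => he.subspace_mem_lagrangians hτ hskew hX
      ((mul_transpose_mul_fin_two X).trans hσ)
  have hne : ∀ X Y : Matrix (Fin 2) (Fin 2) K, X * X = X → X * Y ≠ Y →
      IsStarIso.subspace e X ≠ IsStarIso.subspace e Y :=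
    fun X Y hX hXY heq => hXY (he.mul_eq_of_subspace_eq hnd hskew hX heq)
  refine ⟨_, _, _, hmem !![1, 0; 0, 0] ?_ ?_, hmem !![0, 0; 0, 1] ?_ ?_, hmem !![1, 0; 1, 0] ?_ ?_,
    hne _ _ ?_ fun h => ?_, hne _ _ ?_ fun h => ?_, hne _ _ ?_ fun h => ?_⟩
  case refine_8 => simpa using congrFun (congrFun h 1) 1
  case refine_10 => simpa using congrFun (congrFun h 1) 0
  case refine_12 => simpa using congrFun (congrFun h 0) 0
  all_goals
    ext i j
    fin_cases i <;> fin_cases j <;> simp [Matrix.mul_apply, Fin.sum_univ_two]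

end Classification

/-- Let `K` be a field with `6` invertible, and `t : V × V → T` a fully
nondegenerate alternating `K`-tensor, represented by the skew-symmetric matrix of linear
forms `B`, with `det(B) = f²` for a smooth homogeneous cubic `f ∈ K[y₁,y₂,y₃]` whose zero
locus has a `K`-rational flex point.  Here `𝒯(t)` is the set of totally isotropic subspaces
of dimension `(1/2)·dim_K V`.  Then:
(1) `|𝒯(t)| = 2` iff `Cent(t)` consists exactly of the scalar triples and `Adj(t)` is
*-isomorphic to `X₁(K)`;
(2) `|𝒯(t)| > 2` iff `Cent(t)` consists exactly of the scalar triples and `Adj(t)` is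
*-isomorphic to `S₂(K)`. -/
theorem statement18 {K : Type*} [Field K] (hsix : (6 : K) ≠ 0)
    {ι : Type*} [Fintype ι] [DecidableEq ι]
    (B : Fin 3 → Matrix ι ι K)
    (hskew : ∀ k, (B k)ᵀ = -(B k))
    (halt : ∀ u, matTensor B u u = 0)
    (hnd : ∀ u, (∀ w, matTensor B u w = 0) → u = 0)
    (hfull : Submodule.span K {w : Fin 3 → K | ∃ u v, matTensor B u v = w} = ⊤)
    (f : MvPolynomial (Fin 3) K) (hsmooth : SmoothCubic f) (hflex : HasRationalFlex f)
    (hdet : (polyMat B).det = f ^ 2) :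
    ((∃ U W : Submodule K (ι → K), U ≠ W ∧
        {U' : Submodule K (ι → K) | (∀ u ∈ U', ∀ w ∈ U', matTensor B u w = 0) ∧
          2 * Module.finrank K U' = Module.finrank K (ι → K)} = {U, W}) ↔
      (centTriples B = {c | ∃ lam : K, c = (lam • 1, lam • 1, lam • 1)} ∧
        StarIsoX1 (adjPair B))) ∧
    ((∃ U W X : Submodule K (ι → K),
        ((∀ u ∈ U, ∀ w ∈ U, matTensor B u w = 0) ∧
          2 * Module.finrank K U = Module.finrank K (ι → K)) ∧
        ((∀ u ∈ W, ∀ w ∈ W, matTensor B u w = 0) ∧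
          2 * Module.finrank K W = Module.finrank K (ι → K)) ∧
        ((∀ u ∈ X, ∀ w ∈ X, matTensor B u w = 0) ∧
          2 * Module.finrank K X = Module.finrank K (ι → K)) ∧
        U ≠ W ∧ U ≠ X ∧ W ≠ X) ↔
      (centTriples B = {c | ∃ lam : K, c = (lam • 1, lam • 1, lam • 1)} ∧
        StarIsoS2 (adjPair B))) := by
  have h2K : (2 : K) ≠ 0 := fun h => hsix (by linear_combination 3 * h)
  have h2 : (2 : AlgebraicClosure K) ≠ 0 := fun h =>
    h2K ((algebraMap K (AlgebraicClosure K)).injective (by rw [map_ofNat, h, map_zero]))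
  have hτ := isSmoothPencil_of_smoothCubic (L := K) h2K hskew hsmooth hdet
  have hB : (fun k => (B k).map (algebraMap K K)) = B := by
    ext
    simp
  rw [hB] at hτ
  have hS : ∀ A, (A, A) ∈ adjPair B → ∃ c : K, A = c • 1 := fun A =>
    exists_eq_smul_one h2 (isSmoothPencil_of_smoothCubic h2 hskew hsmooth hdet)
  have hcent := centTriples_eq hnd hskew hfull hS
  constructor
  · constructor
    · rintro ⟨U, W, hUW, hT⟩
      have hT : lagrangians B = {U, W} := hT
      refine ⟨hcent, ?_⟩
      refine (starIsoX1_or_starIsoS2 hτ hnd hskew hS (hT ▸ Or.inl rfl) (hT ▸ Or.inr rfl)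
        hUW).resolve_right fun h => ?_
      obtain ⟨X, Y, Z, hX, hY, hZ, hXY, hXZ, hYZ⟩ :=
        exists_three_lagrangians_of_starIsoS2 hτ hnd hskew h
      rw [hT] at hX hY hZ
      rcases hX with rfl | rfl <;> rcases hY with rfl | rfl <;> rcases hZ with rfl | rfl <;>
        contradiction
    · rintro ⟨-, h⟩
      exact lagrangians_eq_pair_of_starIsoX1 hτ hnd hskew h
  · constructor
    · rintro ⟨X, Y, Z, hX, hY, hZ, hXY, hXZ, hYZ⟩
      refine ⟨hcent, (starIsoX1_or_starIsoS2 hτ hnd hskew hS hX hY hXY).resolve_left fun h => ?_⟩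
      obtain ⟨U, W, -, hT⟩ := lagrangians_eq_pair_of_starIsoX1 hτ hnd hskew h
      have hX : X ∈ lagrangians B := hX
      have hY : Y ∈ lagrangians B := hY
      have hZ : Z ∈ lagrangians B := hZ
      rw [hT] at hX hY hZ
      rcases hX with rfl | rfl <;> rcases hY with rfl | rfl <;> rcases hZ with rfl | rfl <;>
        contradiction
    · rintro ⟨-, h⟩
      exact exists_three_lagrangians_of_starIsoS2 hτ hnd hskew h
end

section
/- Let F be a finite field of odd characteristic p, and let s : V × V → T and t : V' × V' → T' be alternating, fully nondegenerate F-tensors whose centroids both equal the scalars, i.e. Cent(s) = {(λ·id, λ·id, λ·id) : λ ∈ F} and likewise for t. If the Baer groups G_s(F) and G_t(F) are isomorphic as abstract groups, then any Pfaffians Pf(s) ∈ F[y₁,…,y_d] and Pf(t) ∈ F[y₁,…,y_d] of s and t are projectively semi-equivalent: there exist M ∈ GL_d(F), σ ∈ Gal(F/F_p), and c ∈ F^× such that σ(Pf(s))(M·y) = c·Pf(t)(y), where σ(Pf(s)) is obtained by applying σ to the coefficients of Pf(s). -/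
open Matrix

/-- The Baer multiplication on `V × T` associated with a bilinear map `t`. -/
def baerMul {K V T : Type*} [Field K] [AddCommGroup V] [Module K V]
    [AddCommGroup T] [Module K T] (t : V → V → T) (x y : V × T) : V × T :=
  (x.1 + y.1, x.2 + y.2 + (2 : K)⁻¹ • t x.1 y.1)

section MatTensor

variable {K : Type*} [CommRing K] {ι : Type*} [Fintype ι] {d : ℕ} (B : Fin d → Matrix ι ι K)

lemma matTensor_add_left (u u' v : ι → K) :
    matTensor B (u + u') v = matTensor B u v + matTensor B u' v := by
  ext k; simp [matTensor, add_dotProduct]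

lemma matTensor_smul_left (c : K) (u v : ι → K) :
    matTensor B (c • u) v = c • matTensor B u v := by
  ext k; simp [matTensor, smul_dotProduct]

lemma matTensor_smul_right (c : K) (u v : ι → K) :
    matTensor B u (c • v) = c • matTensor B u v := by
  ext k; simp [matTensor, mulVec_smul, dotProduct_smul]

lemma matTensor_sub_left (u u' v : ι → K) :
    matTensor B (u - u') v = matTensor B u v - matTensor B u' v := by
  ext k; simp [matTensor, sub_dotProduct]

lemma matTensor_zero_left (v : ι → K) : matTensor B 0 v = 0 := by
  ext k; simp [matTensor]

lemma matTensor_zero_right (u : ι → K) : matTensor B u 0 = 0 := by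
  ext k; simp [matTensor]

lemma matTensor_swap (hB : ∀ k, (B k)ᵀ = -(B k)) (u v : ι → K) :
    matTensor B v u = -matTensor B u v := by
  ext k
  simp only [matTensor, Pi.neg_apply]
  rw [dotProduct_comm, ← vecMul_transpose, hB, vecMul_neg, neg_dotProduct, dotProduct_mulVec]

lemma matTensor_single [DecidableEq ι] (i j : ι) (k : Fin d) :
    matTensor B (Pi.single i 1) (Pi.single j 1) k = B k i j := by
  simp [matTensor]

end MatTensor

/-- Matrices inducing the same bilinear form agree. -/
lemma Matrix.ext_dotProduct_mulVec {K : Type*} [CommRing K] {ι ι' : Type*} [Fintype ι]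
    [Fintype ι'] [DecidableEq ι] [DecidableEq ι'] {P Q : Matrix ι ι' K}
    (h : ∀ u v, u ⬝ᵥ P *ᵥ v = u ⬝ᵥ Q *ᵥ v) : P = Q := by
  ext i j
  simpa using h (Pi.single i 1) (Pi.single j 1)

/-- An additive self-adjoint pair on a fully nondegenerate tensor with scalar centroid is scalar. -/
lemma exists_scalar_of_additive_centroid {F : Type*} [Field F] {ι : Type*} [Fintype ι]
    [DecidableEq ι] {d : ℕ} (B : Fin d → Matrix ι ι F)
    (hnd : ∀ u, (∀ w, matTensor B u w = 0) → u = 0)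
    (hfull : Submodule.span F {w : Fin d → F | ∃ u v, matTensor B u v = w} = ⊤)
    (hcent : centTriples B = {c | ∃ lam : F, c = (lam • 1, lam • 1, lam • 1)})
    (a : (ι → F) →+ (ι → F)) (c : (Fin d → F) →+ (Fin d → F))
    (hl : ∀ u v, matTensor B (a u) v = c (matTensor B u v))
    (hr : ∀ u v, matTensor B u (a v) = c (matTensor B u v)) :
    ∃ μ : F, (∀ u, a u = μ • u) ∧ ∀ w, c w = μ • w := by
  have hc0 (m : F) (u v) : c (m • matTensor B u v) = m • c (matTensor B u v) := by
    rw [← matTensor_smul_right, ← hl, matTensor_smul_right, hl]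
  have ha (m : F) (u) : a (m • u) = m • a u := by
    rw [← sub_eq_zero]
    refine hnd _ fun w => ?_
    rw [matTensor_sub_left, hl, matTensor_smul_left, matTensor_smul_left, hc0, hl, sub_self]
  have hc (w) : ∀ m : F, c (m • w) = m • c w := by
    have hw : w ∈ Submodule.span F {w : Fin d → F | ∃ u v, matTensor B u v = w} := by
      rw [hfull]; trivial
    induction hw using Submodule.span_induction with
    | mem x hx => obtain ⟨u, v, rfl⟩ := hx; exact fun m => hc0 m u v
    | zero => simp
    | add x y _ _ hx hy => intro m; rw [smul_add, map_add, map_add, hx, hy, smul_add]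
    | smul r x _ hx => intro m; rw [smul_smul, hx, hx, smul_smul]
  let A : (ι → F) →ₗ[F] (ι → F) := { a with map_smul' := ha }
  let C : (Fin d → F) →ₗ[F] (Fin d → F) := { c with map_smul' := fun m w => hc w m }
  have hA (u) : LinearMap.toMatrix' A *ᵥ u = a u := LinearMap.toMatrix'_mulVec A u
  have hC (w) : LinearMap.toMatrix' C *ᵥ w = c w := LinearMap.toMatrix'_mulVec C w
  have hL (u v : ι → F) (k) : u ⬝ᵥ ((LinearMap.toMatrix' A)ᵀ * B k) *ᵥ v = c (matTensor B u v) k := by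
    rw [← hl, ← mulVec_mulVec, dotProduct_mulVec, vecMul_transpose, hA]; rfl
  have hmem : (LinearMap.toMatrix' A, LinearMap.toMatrix' A, LinearMap.toMatrix' C) ∈
      centTriples B := by
    refine ⟨fun k => ext_dotProduct_mulVec fun u v => ?_,
      fun k => ext_dotProduct_mulVec fun u v => ?_⟩
    · rw [hL, ← hr, ← mulVec_mulVec, hA]; rfl
    · rw [hL, ← hC, sum_mulVec, dotProduct_sum]
      simp only [smul_mulVec, dotProduct_smul]
      rfl
  rw [hcent] at hmem
  obtain ⟨μ, hμ⟩ := hmem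
  simp only [Prod.mk.injEq] at hμ
  refine ⟨μ, fun u => ?_, fun w => ?_⟩
  · rw [← hA, hμ.1, smul_mulVec, one_mulVec]
  · rw [← hC, hμ.2.2, smul_mulVec, one_mulVec]

/-- An isomorphism of Baer groups induces a pair of additive isomorphisms intertwining the
tensors. -/
lemma exists_pseudo_isometry_of_baer_equiv {F : Type*} [Field F] (h2 : (2 : F) ≠ 0)
    {ι ι' : Type*} [Fintype ι] [Fintype ι'] {d d' : ℕ}
    (Bs : Fin d → Matrix ι ι F) (Bt : Fin d' → Matrix ι' ι' F)
    (hskews : ∀ k, (Bs k)ᵀ = -(Bs k)) (hskewt : ∀ k, (Bt k)ᵀ = -(Bt k))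
    (hnds : ∀ u, (∀ w, matTensor Bs u w = 0) → u = 0)
    (hndt : ∀ u, (∀ w, matTensor Bt u w = 0) → u = 0)
    (e : (ι → F) × (Fin d → F) ≃ (ι' → F) × (Fin d' → F))
    (he : ∀ x y, e (baerMul (K := F) (matTensor Bs) x y) =
        baerMul (K := F) (matTensor Bt) (e x) (e y)) :
    ∃ (α : (ι → F) ≃+ (ι' → F)) (γ : (Fin d → F) ≃+ (Fin d' → F)),
      ∀ u v, matTensor Bt (α u) (α v) = γ (matTensor Bs u v) := by
  have hhalf (x : Fin d' → F) : (2 : F)⁻¹ • x + (2 : F)⁻¹ • x = x := by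
    rw [← add_smul, ← two_mul, mul_inv_cancel₀ h2, one_smul]
  have hfst0 (w) : (e (0, w)).1 = 0 := by
    refine hndt _ fun v => ?_
    obtain ⟨y, hy⟩ := e.surjective (v, 0)
    have h : e (baerMul (K := F) (matTensor Bs) (0, w) y) =
        e (baerMul (K := F) (matTensor Bs) y (0, w)) := by
      congr 1
      simp [baerMul, matTensor_zero_left, matTensor_zero_right, add_comm]
    rw [he, he, hy] at h
    have h := congrArg Prod.snd h
    simp only [baerMul, zero_add, add_zero, add_right_inj] at h
    rw [matTensor_swap Bt hskewt (e (0, w)).1 v, smul_neg] at h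
    rw [← hhalf (matTensor Bt _ v)]
    nth_rewrite 1 [h]
    simp
  have hfst (u w) : (e (u, w)).1 = (e (u, 0)).1 := by
    have h := congrArg Prod.fst (he (u, 0) (0, w))
    simpa [baerMul, hfst0, matTensor_zero_right] using h
  let α : (ι → F) →+ (ι' → F) := AddMonoidHom.mk' (fun u => (e (u, 0)).1) fun u v => by
    have h := congrArg Prod.fst (he (u, 0) (v, 0))
    simp only [baerMul] at h
    rwa [hfst] at h
  let γ : (Fin d → F) →+ (Fin d' → F) := AddMonoidHom.mk' (fun w => (e (0, w)).2) fun u v => by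
    have h := congrArg Prod.snd (he (0, u) (0, v))
    simpa [baerMul, hfst0, matTensor_zero_right] using h
  have hα (x) : (e x).1 = α x.1 := hfst x.1 x.2
  have hγ (w) : e (0, w) = (0, γ w) := Prod.ext (hfst0 w) rfl
  have hst (u v) : matTensor Bt (α u) (α v) = γ (matTensor Bs u v) := by
    have h : baerMul (K := F) (matTensor Bs) (u, 0) (v, 0) =
        baerMul (K := F) (matTensor Bs) (baerMul (K := F) (matTensor Bs) (v, 0) (u, 0))
          (0, matTensor Bs u v) := by
      refine Prod.ext ?_ ?_
      · simp [baerMul, add_comm]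
      · ext k
        simp [baerMul, matTensor_zero_right, matTensor_swap Bs hskews u v]
        field_simp
        ring
    have h := congrArg e h
    rw [he, he, he, hγ] at h
    have h := congrArg Prod.snd h
    simp only [baerMul, hα, matTensor_zero_right, smul_zero, add_zero] at h
    rw [matTensor_swap Bt hskewt (α u) (α v), add_comm (e (u, 0)).2, add_assoc, add_assoc,
      add_assoc, smul_neg] at h
    rw [← hhalf (matTensor Bt _ _)]
    ext k
    have h := congrFun h k
    simp only [Pi.add_apply, Pi.neg_apply] at h ⊢
    linear_combination h
  have hγi : Function.Injective γ := fun w w' h => by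
    have : e (0, w) = e (0, w') := by rw [hγ, hγ, h]
    exact congrArg Prod.snd (e.injective this)
  have hαi : Function.Injective α := by
    refine (injective_iff_map_eq_zero α).2 fun u hu => hnds u fun v => hγi ?_
    rw [← hst, hu, matTensor_zero_left, map_zero]
  have hαs : Function.Surjective α := fun v => by
    obtain ⟨x, hx⟩ := e.surjective (v, 0)
    exact ⟨x.1, by rw [← hα, hx]⟩
  have hγs : Function.Surjective γ := fun w => by
    obtain ⟨x, hx⟩ := e.surjective (0, w)
    have h0 : x.1 = 0 := hαi (by rw [← hα, hx, map_zero])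
    refine ⟨x.2, ?_⟩
    have h := hγ x.2
    rw [← h0, Prod.mk.eta, hx] at h
    exact (congrArg Prod.snd h).symm
  exact ⟨AddEquiv.ofBijective α ⟨hαi, hαs⟩, AddEquiv.ofBijective γ ⟨hγi, hγs⟩, hst⟩

/-- If the target tensor has scalar centroid, additive isomorphisms intertwining two tensors are
semilinear for a common field automorphism. -/
lemma exists_ringEquiv_semilinear {F : Type*} [Field F] [Finite F]
    {ι ι' : Type*} [Fintype ι] [Fintype ι'] [DecidableEq ι'] {d d' : ℕ}
    (Bs : Fin d → Matrix ι ι F) (Bt : Fin d' → Matrix ι' ι' F)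
    (hnd : ∀ u, (∀ w, matTensor Bt u w = 0) → u = 0)
    (hfull : Submodule.span F {w : Fin d' → F | ∃ u v, matTensor Bt u v = w} = ⊤)
    (hcent : centTriples Bt = {c | ∃ lam : F, c = (lam • 1, lam • 1, lam • 1)})
    (α : (ι → F) ≃+ (ι' → F)) (γ : (Fin d → F) ≃+ (Fin d' → F))
    (h : ∀ u v, matTensor Bt (α u) (α v) = γ (matTensor Bs u v)) :
    ∃ σ : F ≃+* F, (∀ (m : F) u, α (m • u) = σ m • α u) ∧
      ∀ (m : F) w, γ (m • w) = σ m • γ w := by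
  have key (m : F) : ∃ μ : F, (∀ u, α (m • u) = μ • α u) ∧ ∀ w, γ (m • w) = μ • γ w := by
    obtain ⟨μ, h1, h2⟩ := exists_scalar_of_additive_centroid Bt hnd hfull hcent
      ((α.toAddMonoidHom.comp (DistribSMul.toAddMonoidHom _ m)).comp α.symm.toAddMonoidHom)
      ((γ.toAddMonoidHom.comp (DistribSMul.toAddMonoidHom _ m)).comp γ.symm.toAddMonoidHom)
      (fun u v => by
        obtain ⟨u, rfl⟩ := α.surjective u
        obtain ⟨v, rfl⟩ := α.surjective v
        simp [h, matTensor_smul_left])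
      (fun u v => by
        obtain ⟨u, rfl⟩ := α.surjective u
        obtain ⟨v, rfl⟩ := α.surjective v
        simp [h, matTensor_smul_right])
    exact ⟨μ, fun u => by simpa using h1 (α u), fun w => by simpa using h2 (γ w)⟩
  cases isEmpty_or_nonempty ι' with
  | inl hι =>
    have hT (w : Fin d' → F) : w = 0 := by
      have hw : w ∈ Submodule.span F {w : Fin d' → F | ∃ u v, matTensor Bt u v = w} := by
        rw [hfull]; trivial
      have hs : Submodule.span F {w : Fin d' → F | ∃ u v, matTensor Bt u v = w} ≤ ⊥ := by
        rw [Submodule.span_le]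
        rintro _ ⟨u, v, rfl⟩
        rw [Subsingleton.elim u 0, matTensor_zero_left]
        exact Submodule.zero_mem _
      exact (Submodule.mem_bot F).1 (hs hw)
    exact ⟨RingEquiv.refl F, fun _ _ => Subsingleton.elim _ _,
      fun _ _ => (hT _).trans (hT _).symm⟩
  | inr hι =>
    obtain ⟨v, hv⟩ := exists_ne (0 : ι' → F)
    obtain ⟨u, rfl⟩ := α.surjective v
    choose σ h1 h2 using key
    have inj {a b : F} (hab : a • α u = b • α u) : a = b := smul_left_injective F hv hab
    let φ : F →+* F :=
      { toFun := σ
        map_one' := inj (by rw [← h1, one_smul, one_smul])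
        map_mul' := fun a b => inj (by rw [← h1, mul_smul, h1, h1, mul_smul])
        map_zero' := inj (by rw [← h1, zero_smul, zero_smul, map_zero])
        map_add' := fun a b => inj (by rw [← h1, add_smul, map_add, h1, h1, add_smul]) }
    exact ⟨RingEquiv.ofBijective φ (Finite.injective_iff_bijective.1 φ.injective), h1, h2⟩

/-- A semilinear bijection of coordinate spaces is a matrix composed with a field automorphism. -/
lemma exists_matrix_of_semilinear {F : Type*} [Field F] {ι ι' : Type*} [Fintype ι]
    [DecidableEq ι] (σ : F ≃+* F) (α : (ι → F) ≃+ (ι' → F))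
    (h : ∀ (m : F) u, α (m • u) = σ m • α u) :
    ∃ A : Matrix ι' ι F, (∀ u, α u = A *ᵥ (σ ∘ u)) ∧ Function.Surjective A.mulVec := by
  have hA (u) : α u = (of fun i j => α (Pi.single j 1) i : Matrix ι' ι F) *ᵥ (σ ∘ u) := by
    conv_lhs => rw [pi_eq_sum_univ' u]
    ext i
    simp [mulVec, dotProduct, h, mul_comm]
  exact ⟨_, hA, fun v => by
    obtain ⟨u, rfl⟩ := α.surjective v
    exact ⟨_, (hA u).symm⟩⟩

/-- Let `F` be a finite field of odd characteristic `p`, and let `s`, `t`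
be alternating, fully nondegenerate `F`-tensors (represented by skew-symmetric matrices of
linear forms `Bs`, `Bt`) whose centroids both equal the scalars.  If the Baer groups
`G_s(F)` and `G_t(F)` are isomorphic as abstract groups, then any Pfaffians
`fs, ft ∈ F[y₁,…,y_d]` of `s` and `t` (homogeneous of degree `n`, with `fs² = det(Bs)` and
`ft² = det(Bt)`) are projectively semi-equivalent: there exist `M ∈ GL_d(F)`,
`σ ∈ Gal(F/F_p)` (= a ring automorphism of `F`) and `c ∈ F^×` with
`σ(fs)(M·y) = c·ft(y)`, where `σ(fs)` applies `σ` to the coefficients of `fs`. -/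
theorem statement19 {F : Type*} [Field F] [Fintype F] (p : ℕ) [CharP F p] (hodd : Odd p)
    {ι ι' : Type*} [Fintype ι] [DecidableEq ι] [Fintype ι'] [DecidableEq ι']
    {d n : ℕ}
    (Bs : Fin d → Matrix ι ι F) (Bt : Fin d → Matrix ι' ι' F)
    (hskews : ∀ k, (Bs k)ᵀ = -(Bs k)) (hskewt : ∀ k, (Bt k)ᵀ = -(Bt k))
    (halts : ∀ u, matTensor Bs u u = 0) (haltt : ∀ u, matTensor Bt u u = 0)
    (hnds : ∀ u, (∀ w, matTensor Bs u w = 0) → u = 0)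
    (hndt : ∀ u, (∀ w, matTensor Bt u w = 0) → u = 0)
    (hfulls : Submodule.span F {w : Fin d → F | ∃ u v, matTensor Bs u v = w} = ⊤)
    (hfullt : Submodule.span F {w : Fin d → F | ∃ u v, matTensor Bt u v = w} = ⊤)
    (hcents : centTriples Bs = {c | ∃ lam : F, c = (lam • 1, lam • 1, lam • 1)})
    (hcentt : centTriples Bt = {c | ∃ lam : F, c = (lam • 1, lam • 1, lam • 1)})
    (fs ft : MvPolynomial (Fin d) F)
    (hfs : fs.IsHomogeneous n) (hft : ft.IsHomogeneous n)
    (hfs2 : fs ^ 2 = (polyMat Bs).det) (hft2 : ft ^ 2 = (polyMat Bt).det)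
    (hiso : ∃ e : (ι → F) × (Fin d → F) ≃ (ι' → F) × (Fin d → F),
      ∀ x y, e (baerMul (K := F) (matTensor Bs) x y) =
        baerMul (K := F) (matTensor Bt) (e x) (e y)) :
    ∃ M : Matrix (Fin d) (Fin d) F, IsUnit M ∧ ∃ σ : F ≃+* F, ∃ c : F, c ≠ 0 ∧
      (MvPolynomial.bind₁
          (fun i : Fin d => ∑ j : Fin d, MvPolynomial.C (M i j) * MvPolynomial.X j))
        (MvPolynomial.map (σ : F →+* F) fs) = MvPolynomial.C c * ft := by
  have h2 : (2 : F) ≠ 0 := by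
    refine Ring.two_ne_zero ?_
    rw [ringChar.eq F p]
    rintro rfl
    exact absurd hodd (by decide)
  obtain ⟨e, he⟩ := hiso
  obtain ⟨α, γ, hst⟩ :=
    exists_pseudo_isometry_of_baer_equiv h2 Bs Bt hskews hskewt hnds hndt e he
  obtain ⟨σ, hα, hγ⟩ := exists_ringEquiv_semilinear Bs Bt hndt hfullt hcentt α γ hst
  obtain ⟨A, hA, hAs⟩ := exists_matrix_of_semilinear σ α hα
  obtain ⟨G, hG, hGs⟩ := exists_matrix_of_semilinear σ γ hγ
  have hcard : Fintype.card ι = Fintype.card ι' := by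
    have h := Fintype.card_congr α.toEquiv
    rw [Fintype.card_fun, Fintype.card_fun] at h
    exact Nat.pow_right_injective Fintype.one_lt_card h
  let ε : ι' ≃ ι := Fintype.equivOfCardEq hcard.symm
  have hdet : (A.submatrix ε.symm id).det ≠ 0 := by
    rw [← isUnit_iff_ne_zero, ← isUnit_iff_isUnit_det, ← mulVec_surjective_iff_isUnit]
    intro v
    obtain ⟨u, hu⟩ := hAs (v ∘ ε)
    refine ⟨u, ?_⟩
    ext i
    simpa [mulVec] using congrFun hu (ε.symm i)
  have hcoef (k : Fin d) : Aᵀ * Bt k * A = ∑ l, G k l • (Bs l).map σ := by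
    ext i j
    have h := congrFun (hst (Pi.single i 1) (Pi.single j 1)) k
    have hs (i : ι) : (σ : F → F) ∘ (Pi.single i 1 : ι → F) = Pi.single i 1 := by
      ext j; by_cases hj : j = i
      · subst hj; simp
      · simp [hj]
    rw [hA, hA, hG, hs, hs] at h
    rw [matTensor, mulVec_single_one, mulVec_single_one] at h
    rw [Matrix.mul_assoc, mul_apply', Matrix.sum_apply]
    refine h.trans ?_
    simp [mulVec, dotProduct, matTensor_single]
  refine ⟨Gᵀ, ?_, σ, ?_⟩
  · rw [isUnit_transpose, ← mulVec_surjective_iff_isUnit]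
    exact hGs
  let ψ : MvPolynomial (Fin d) F →+* MvPolynomial (Fin d) F :=
    ((MvPolynomial.bind₁ (fun i : Fin d => ∑ j : Fin d,
      MvPolynomial.C (Gᵀ i j) * MvPolynomial.X j)) : _ →ₐ[F] _).toRingHom.comp
      (MvPolynomial.map (σ : F →+* F))
  have hψC (a : F) : ψ (MvPolynomial.C a) = MvPolynomial.C (σ a) := by
    simp [ψ]
  have hψX (l : Fin d) : ψ (MvPolynomial.X l) =
      ∑ k, MvPolynomial.C (G k l) * MvPolynomial.X k := by
    simp [ψ]
  let P : Matrix ι' ι (MvPolynomial (Fin d) F) := A.map MvPolynomial.C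
  have hpoly : (polyMat Bs).map ψ = Pᵀ * polyMat Bt * P := by
    have hl : polyMat Bt = ∑ k, (MvPolynomial.X k : MvPolynomial (Fin d) F) •
        (Bt k).map MvPolynomial.C := by
      ext1 i j
      simp [polyMat, Matrix.sum_apply, mul_comm]
    have hk (k : Fin d) : Pᵀ * ((Bt k).map MvPolynomial.C : Matrix ι' ι' (MvPolynomial (Fin d) F)) * P =
          (∑ l, G k l • (Bs l).map σ).map (MvPolynomial.C : F →+* MvPolynomial (Fin d) F) := by
      rw [← hcoef, Matrix.map_mul, Matrix.map_mul, ← transpose_map]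
    rw [hl, Matrix.mul_sum, Matrix.sum_mul]
    simp only [Matrix.mul_smul, Matrix.smul_mul, hk]
    ext1 i j
    simp only [polyMat, Matrix.sum_apply, map_apply, of_apply, Matrix.smul_apply, map_sum,
      map_mul, hψC, hψX, smul_eq_mul, Finset.mul_sum]
    rw [Finset.sum_comm]
    refine Finset.sum_congr rfl fun k _ => Finset.sum_congr rfl fun l _ => ?_
    ring
  have hsq : ψ fs ^ 2 =
      (MvPolynomial.C (A.submatrix ε.symm id).det * ft) ^ 2 := by
    have hP : Pᵀ * polyMat Bt * P = (P.submatrix ε.symm id)ᵀ *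
        (polyMat Bt).submatrix ε.symm ε.symm * P.submatrix ε.symm id := by
      rw [transpose_submatrix, submatrix_mul_equiv, submatrix_mul_equiv, submatrix_id_id]
    have hdetP : (P.submatrix ε.symm id).det =
        MvPolynomial.C (A.submatrix ε.symm id).det := by
      rw [RingHom.map_det]
      rfl
    rw [← map_pow, hfs2, RingHom.map_det, RingHom.mapMatrix_apply, hpoly, hP, det_mul, det_mul,
      det_transpose, det_submatrix_equiv_self, hdetP, ← hft2]
    ring
  rcases sq_eq_sq_iff_eq_or_eq_neg.1 hsq with h | h
  · exact ⟨_, hdet, h⟩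
  · refine ⟨_, neg_ne_zero.2 hdet, ?_⟩
    rw [map_neg, neg_mul]
    exact h
end
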